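/- Let d ≥ 5 and let u be a classical solution of the wave-Hartree equation on [a,b] × ℝ^d which is compactly supported in space on [a,b]. Set M = sup_{t∈[a,b]} ∫_{ℝ^d} (|∇u(t,x)|² + |∂ₜu(t,x)|²) dx and assume M < ∞. Then there exists a constant C depending only on d such that ∫_a^b ∫_{ℝ^d} |u(t,x)|^{2d/(d−2)} / |x| dx dt ≤ C · M^{d/(d−2)}. -/

import Mathlib

open MeasureTheory
open scoped ENNReal RealInnerProductSpace

noncomputable section

/-- Euclidean space `ℝ^d`. -/
abbrev Ed (d : ℕ) : Type := EuclideanSpace ℝ (Fin d)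

/-- The time derivative `∂ₜ u (t,x)`. -/
def timeDeriv {d : ℕ} (u : ℝ → Ed d → ℝ) (t : ℝ) (x : Ed d) : ℝ :=
  deriv (fun s => u s x) t

/-- The spatial Laplacian `Δ f (x) = ∑ i ∂²f/∂xᵢ²`. -/
def spaceLaplacian {d : ℕ} (f : Ed d → ℝ) (x : Ed d) : ℝ :=
  ∑ i : Fin d, iteratedDeriv 2 (fun s : ℝ => f (x + s • EuclideanSpace.single i 1)) 0

/-- The Hartree potential `(|·|⁻⁴ ∗ f²)(x) = ∫ f(y)² |x-y|⁻⁴ dy`. -/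
def hartreePot {d : ℕ} (f : Ed d → ℝ) (x : Ed d) : ℝ :=
  ∫ y : Ed d, (f y) ^ 2 / ‖x - y‖ ^ 4

/-- `u` is a classical (C²) solution of the defocusing energy-critical wave-Hartree
equation `∂ₜₜu - Δu + (|·|⁻⁴ ∗ |u|²) u = 0` on the time interval `I`. -/
def IsWaveHartreeSol {d : ℕ} (I : Set ℝ) (u : ℝ → Ed d → ℝ) : Prop :=
  ContDiff ℝ 2 (fun p : ℝ × Ed d => u p.1 p.2) ∧
  ∀ t ∈ I, ∀ x : Ed d,
    iteratedDeriv 2 (fun s => u s x) t - spaceLaplacian (u t) x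
      + hartreePot (u t) x * u t x = 0

lemma zero_of_hasLineDerivAt {d : ℕ} {F F' : Ed d → ℝ} {v : Ed d} {R : ℝ}
    (h0 : ∀ x, R < ‖x‖ → F x = 0) (hd : ∀ x, HasLineDerivAt ℝ F (F' x) x v)
    (x : Ed d) (hx : R < ‖x‖) : F' x = 0 := by
  have h1 : F =ᶠ[nhds x] fun _ => (0 : ℝ) := by
    filter_upwards [(isOpen_lt continuous_const continuous_norm).mem_nhds hx] with y hy
    exact h0 y hy
  have h2 : HasLineDerivAt ℝ F 0 x v := by
    have : HasFDerivAt F (0 : Ed d →L[ℝ] ℝ) x :=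
      (hasFDerivAt_const (0 : ℝ) x).congr_of_eventuallyEq h1
    simpa using this.hasLineDerivAt v
  exact (hd x).unique h2

lemma hasCompactSupport_of_zero {d : ℕ} {F : Ed d → ℝ} {R : ℝ}
    (h0 : ∀ x, R < ‖x‖ → F x = 0) : HasCompactSupport F := by
  refine HasCompactSupport.intro (isCompact_closedBall (0 : Ed d) R) fun x hx => h0 x ?_
  simpa using hx

lemma integrable_of_zero {d : ℕ} {F : Ed d → ℝ} {R : ℝ} (hF : Continuous F)
    (h0 : ∀ x, R < ‖x‖ → F x = 0) : Integrable F :=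
  hF.integrable_of_hasCompactSupport (hasCompactSupport_of_zero h0)

lemma integral_lineDeriv_eq_zero {d : ℕ} {F F' : Ed d → ℝ} {v : Ed d} {R : ℝ}
    (hF : Continuous F) (hF' : Continuous F') (h0 : ∀ x, R < ‖x‖ → F x = 0)
    (hd : ∀ x, HasLineDerivAt ℝ F (F' x) x v) : ∫ x, F' x = 0 := by
  have h0' := zero_of_hasLineDerivAt h0 hd
  have key := integral_bilinear_hasLineDerivAt_right_eq_neg_left_of_integrable
    (μ := (volume : Measure (Ed d))) (f := fun _ : Ed d => (1 : ℝ)) (f' := fun _ => (0 : ℝ))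
    (g := F) (g' := F') (v := v) (B := ContinuousLinearMap.mul ℝ ℝ)
    (by simp) (by simpa using integrable_of_zero hF' h0')
    (by simpa using integrable_of_zero hF h0)
    (fun x _ => by simpa using (hasFDerivAt_const (1 : ℝ) x).hasLineDerivAt v)
    (fun x _ => hd x)
  simpa using key

/-- A divergence theorem for compactly supported vector fields. -/
lemma integral_sum_lineDeriv_eq_zero {d : ℕ} {F F' : Fin d → Ed d → ℝ} {R : ℝ}
    (hF : ∀ j, Continuous (F j)) (hF' : ∀ j, Continuous (F' j))
    (h0 : ∀ j x, R < ‖x‖ → F j x = 0)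
    (hd : ∀ j x, HasLineDerivAt ℝ (F j) (F' j x) x (EuclideanSpace.single j 1)) :
    ∫ x, ∑ j, F' j x = 0 := by
  rw [integral_finsetSum]
  · exact Finset.sum_eq_zero fun j _ =>
      integral_lineDeriv_eq_zero (hF j) (hF' j) (h0 j) (hd j)
  · exact fun j _ => integrable_of_zero (hF' j) (zero_of_hasLineDerivAt (h0 j) (hd j))

/-- The regularized inverse modulus `(ε² + |x|²)^{-1/2}`. -/
def regInv {d : ℕ} (ε : ℝ) (x : Ed d) : ℝ := (√(ε ^ 2 + ‖x‖ ^ 2))⁻¹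

lemma regInv_pos {d : ℕ} {ε : ℝ} (hε : 0 < ε) (x : Ed d) : 0 < regInv ε x := by
  unfold regInv; positivity

lemma regInv_sq {d : ℕ} {ε : ℝ} (hε : 0 < ε) (x : Ed d) :
    regInv ε x ^ 2 * (ε ^ 2 + ‖x‖ ^ 2) = 1 := by
  unfold regInv
  rw [inv_pow, Real.sq_sqrt (by positivity)]
  exact inv_mul_cancel₀ (by positivity)

lemma continuous_regInv {d : ℕ} {ε : ℝ} (hε : 0 < ε) : Continuous (regInv (d := d) ε) := by
  unfold regInv
  refine Continuous.inv₀ (by fun_prop) fun x => ?_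
  positivity

lemma hasDerivAt_normSq_line {d : ℕ} (x : Ed d) (j : Fin d) :
    HasDerivAt (fun s : ℝ => ‖x + s • EuclideanSpace.single j (1 : ℝ)‖ ^ 2) (2 * x j) 0 := by
  have h : HasDerivAt (fun s : ℝ => x + s • EuclideanSpace.single j (1 : ℝ))
      (EuclideanSpace.single j (1 : ℝ)) 0 := by
    simpa using ((hasDerivAt_id (0 : ℝ)).smul_const (EuclideanSpace.single j (1 : ℝ))).const_add x
  have := h.norm_sq
  simpa [EuclideanSpace.inner_single_right] using this

lemma hasLineDerivAt_regInv {d : ℕ} {ε : ℝ} (hε : 0 < ε) (x : Ed d) (j : Fin d) :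
    HasLineDerivAt ℝ (regInv ε) (-(regInv ε x ^ 3 * x j)) x (EuclideanSpace.single j 1) := by
  have h := (((hasDerivAt_normSq_line x j).const_add (ε ^ 2)).sqrt
    (by simp; positivity)).inv (by simp; positivity)
  unfold HasLineDerivAt regInv
  refine h.congr_deriv ?_
  simp only [zero_smul, add_zero]
  have : 0 < √(ε ^ 2 + ‖x‖ ^ 2) := by positivity
  field_simp

lemma hasDerivAt_coord_line {d : ℕ} (x : Ed d) (i j : Fin d) :
    HasLineDerivAt ℝ (fun x : Ed d => x i) (if i = j then 1 else 0) x
      (EuclideanSpace.single j 1) := by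
  unfold HasLineDerivAt
  have := ((hasDerivAt_id (0 : ℝ)).mul_const
    ((EuclideanSpace.single j (1 : ℝ) : Ed d) i)).const_add (x i)
  refine HasDerivAt.congr_deriv (f := fun s : ℝ => (x + s • EuclideanSpace.single j (1:ℝ)) i)
    (by simpa using this) ?_
  simp

lemma normSq_eq_sum {d : ℕ} (x : Ed d) : ‖x‖ ^ 2 = ∑ j, x j * x j := by
  rw [EuclideanSpace.norm_sq_eq]; simp [sq]

/-- The Laplacian of `√(ε² + |x|²)`. -/
def lapReg {d : ℕ} (ε : ℝ) (x : Ed d) : ℝ :=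
  ((d : ℝ) - 1) * regInv ε x + ε ^ 2 * regInv ε x ^ 3

/-- `∂ⱼ lapReg = - xⱼ * dlapReg`. -/
def dlapReg {d : ℕ} (ε : ℝ) (x : Ed d) : ℝ :=
  ((d : ℝ) - 1) * regInv ε x ^ 3 + 3 * ε ^ 2 * regInv ε x ^ 5

/-- `∂ⱼ dlapReg = - xⱼ * ddlapReg`. -/
def ddlapReg {d : ℕ} (ε : ℝ) (x : Ed d) : ℝ :=
  3 * ((d : ℝ) - 1) * regInv ε x ^ 5 + 15 * ε ^ 2 * regInv ε x ^ 7

lemma hasLineDerivAt_lapReg {d : ℕ} {ε : ℝ} (hε : 0 < ε) (x : Ed d) (j : Fin d) :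
    HasLineDerivAt ℝ (lapReg ε) (-(dlapReg ε x * x j)) x (EuclideanSpace.single j 1) := by
  have h : HasDerivAt _ _ _ := hasLineDerivAt_regInv hε x j
  have h2 := (h.const_mul ((d : ℝ) - 1)).add ((h.pow 3).const_mul (ε ^ 2))
  unfold HasLineDerivAt lapReg
  refine h2.congr_deriv ?_
  simp [dlapReg]; ring

lemma hasLineDerivAt_dlapReg {d : ℕ} {ε : ℝ} (hε : 0 < ε) (x : Ed d) (j : Fin d) :
    HasLineDerivAt ℝ (dlapReg ε) (-(ddlapReg ε x * x j)) x (EuclideanSpace.single j 1) := by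
  have h : HasDerivAt _ _ _ := hasLineDerivAt_regInv hε x j
  have h2 := ((h.pow 3).const_mul ((d : ℝ) - 1)).add ((h.pow 5).const_mul (3 * ε ^ 2))
  unfold HasLineDerivAt dlapReg
  refine h2.congr_deriv ?_
  simp [ddlapReg]; ring

lemma continuous_lapReg {d : ℕ} {ε : ℝ} (hε : 0 < ε) : Continuous (lapReg (d := d) ε) := by
  have := continuous_regInv (d := d) hε
  unfold lapReg; fun_prop

lemma continuous_dlapReg {d : ℕ} {ε : ℝ} (hε : 0 < ε) : Continuous (dlapReg (d := d) ε) := by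
  have := continuous_regInv (d := d) hε
  unfold dlapReg; fun_prop

lemma continuous_ddlapReg {d : ℕ} {ε : ℝ} (hε : 0 < ε) : Continuous (ddlapReg (d := d) ε) := by
  have := continuous_regInv (d := d) hε
  unfold ddlapReg; fun_prop

lemma lapReg_eq {d : ℕ} {ε : ℝ} (hε : 0 < ε) (x : Ed d) :
    d * regInv ε x - regInv ε x ^ 3 * ‖x‖ ^ 2 = lapReg ε x := by
  have := regInv_sq hε x
  unfold lapReg
  linear_combination (- regInv ε x) * this

lemma bilap_ge {d : ℕ} (hd : 5 ≤ d) {ε : ℝ} (hε : 0 < ε) (x : Ed d) :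
    8 * regInv ε x ^ 3 ≤ d * dlapReg ε x - ddlapReg ε x * ‖x‖ ^ 2 := by
  have h := regInv_sq hε x
  have hp := regInv_pos hε x
  have hd' : (5 : ℝ) ≤ d := by exact_mod_cast hd
  have : d * dlapReg ε x - ddlapReg ε x * ‖x‖ ^ 2 = ((d : ℝ) - 1) * (d - 3) * regInv ε x ^ 3
      + ε ^ 2 * regInv ε x ^ 5 * (6 * d - 18) + 15 * ε ^ 4 * regInv ε x ^ 7 := by
    unfold dlapReg ddlapReg
    linear_combination (-(3 * ((d : ℝ) - 1) * regInv ε x ^ 3 + 15 * ε ^ 2 * regInv ε x ^ 5)) * h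
  rw [this]
  have h1 : 8 * regInv ε x ^ 3 ≤ ((d : ℝ) - 1) * (d - 3) * regInv ε x ^ 3 := by
    gcongr; nlinarith
  have h2 : 0 ≤ ε ^ 2 * regInv ε x ^ 5 * (6 * d - 18) := by
    apply mul_nonneg (by positivity); linarith
  have h3 : 0 ≤ 15 * ε ^ 4 * regInv ε x ^ 7 := by positivity
  linarith

lemma lapReg_sq_ge {d : ℕ} (hd : 5 ≤ d) {ε : ℝ} (hε : 0 < ε) (x : Ed d) :
    2 * dlapReg ε x * regInv ε x * ‖x‖ ^ 2 ≤ lapReg ε x ^ 2 := by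
  have h := regInv_sq hε x
  have hp := regInv_pos hε x
  have hd' : (4 : ℝ) ≤ (d : ℝ) - 1 := by
    have : (5 : ℝ) ≤ d := by exact_mod_cast hd
    linarith
  unfold dlapReg lapReg
  set n : ℝ := (d : ℝ) - 1
  set φ := regInv ε x
  have hs : 0 ≤ ε ^ 2 * φ ^ 2 := by positivity
  have e1 : 2 * (n * φ ^ 3 + 3 * ε ^ 2 * φ ^ 5) * φ * ‖x‖ ^ 2
      = φ ^ 2 * (2 * (n + 3 * (ε ^ 2 * φ ^ 2)) * (1 - ε ^ 2 * φ ^ 2)) := by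
    linear_combination (2 * φ ^ 2 * (n + 3 * ε ^ 2 * φ ^ 2)) * h
  have e2 : (n * φ + ε ^ 2 * φ ^ 3) ^ 2 = φ ^ 2 * (n + ε ^ 2 * φ ^ 2) ^ 2 := by ring
  rw [e1, e2]
  gcongr
  nlinarith [mul_nonneg hs (by linarith : 0 ≤ n - 4)]

lemma regInv_mul_norm_le {d : ℕ} {ε : ℝ} (hε : 0 < ε) (x : Ed d) :
    regInv ε x ^ 2 * ‖x‖ ^ 2 ≤ 1 := by
  have h := regInv_sq hε x
  have : 0 ≤ regInv ε x ^ 2 * ε ^ 2 := by positivity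
  linarith

/-- The Morawetz multiplier `∇a·∇u + ½ (Δa) u`, with `g` in place of `∇u`. -/
def morMul {d : ℕ} (ε : ℝ) (u : Ed d → ℝ) (g : Fin d → Ed d → ℝ) (x : Ed d) : ℝ :=
  regInv ε x * (∑ i, x i * g i x) + 1 / 2 * lapReg ε x * u x

/-- The positive quadratic form produced by the Morawetz multiplier. -/
def morForm {d : ℕ} (ε : ℝ) (u : Ed d → ℝ) (g : Fin d → Ed d → ℝ) (x : Ed d) : ℝ :=
  regInv ε x * (∑ i, g i x ^ 2) - regInv ε x ^ 3 * (∑ i, x i * g i x) ^ 2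
    + 1 / 4 * (d * dlapReg ε x - ddlapReg ε x * ‖x‖ ^ 2) * u x ^ 2

lemma hasLineDerivAt_sum_coord_mul {d : ℕ} {g : Fin d → Ed d → ℝ} {H : Fin d → Fin d → Ed d → ℝ}
    (hgd : ∀ i j x, HasLineDerivAt ℝ (g i) (H i j x) x (EuclideanSpace.single j 1))
    (x : Ed d) (j : Fin d) :
    HasLineDerivAt ℝ (fun x : Ed d => ∑ i, x i * g i x) (g j x + ∑ i, x i * H i j x) x
      (EuclideanSpace.single j 1) := by
  have h : ∀ i, HasDerivAt _ _ (0 : ℝ) := fun i => hasDerivAt_coord_line x i j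
  have h' : ∀ i, HasDerivAt _ _ (0 : ℝ) := fun i => hgd i j x
  have := HasDerivAt.fun_sum (u := Finset.univ) fun i _ => (h i).mul (h' i)
  unfold HasLineDerivAt
  refine this.congr_deriv ?_
  simp [Finset.sum_add_distrib]

lemma hasLineDerivAt_sum_sq {d : ℕ} {g : Fin d → Ed d → ℝ} {H : Fin d → Fin d → Ed d → ℝ}
    (hgd : ∀ i j x, HasLineDerivAt ℝ (g i) (H i j x) x (EuclideanSpace.single j 1))
    (x : Ed d) (j : Fin d) :
    HasLineDerivAt ℝ (fun x : Ed d => ∑ i, g i x ^ 2) (2 * ∑ i, g i x * H i j x) x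
      (EuclideanSpace.single j 1) := by
  have h' : ∀ i, HasDerivAt _ _ (0 : ℝ) := fun i => hgd i j x
  have := HasDerivAt.fun_sum (u := Finset.univ) fun i _ => (h' i).pow 2
  unfold HasLineDerivAt
  refine this.congr_deriv ?_
  simp [Finset.mul_sum, mul_assoc]

lemma integral_laplacian_mul_morMul {d : ℕ} {ε R : ℝ} (hε : 0 < ε)
    {u : Ed d → ℝ} {g : Fin d → Ed d → ℝ} {H : Fin d → Fin d → Ed d → ℝ}
    (hu : Continuous u) (hg : ∀ i, Continuous (g i)) (hH : ∀ i j, Continuous (H i j))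
    (hud : ∀ j x, HasLineDerivAt ℝ u (g j x) x (EuclideanSpace.single j 1))
    (hgd : ∀ i j x, HasLineDerivAt ℝ (g i) (H i j x) x (EuclideanSpace.single j 1))
    (hsymm : ∀ i j x, H i j x = H j i x)
    (h0 : ∀ x, R < ‖x‖ → u x = 0) :
    ∫ x, ((∑ j, H j j x) * morMul ε u g x + morForm ε u g x) = 0 := by
  have cφ := continuous_regInv (d := d) hε
  have cL := continuous_lapReg (d := d) hε
  have cm := continuous_dlapReg (d := d) hε
  have ck := continuous_ddlapReg (d := d) hε
  have g0 : ∀ j x, R < ‖x‖ → g j x = 0 := fun j => zero_of_hasLineDerivAt h0 (hud j)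
  have cc : ∀ j, Continuous fun x : Ed d => x j := fun j => by fun_prop
  rw [← integral_sum_lineDeriv_eq_zero (R := R)
    (F := fun j x => g j x * (regInv ε x * (∑ i, x i * g i x) + 1 / 2 * (lapReg ε x * u x))
      - 1 / 2 * (regInv ε x * x j * (∑ i, g i x ^ 2)) + 1 / 4 * (dlapReg ε x * x j * u x ^ 2))
    (F' := fun j x => H j j x * (regInv ε x * (∑ i, x i * g i x) + 1 / 2 * (lapReg ε x * u x))
      + g j x * (-(regInv ε x ^ 3 * x j) * (∑ i, x i * g i x)
        + regInv ε x * (g j x + ∑ i, x i * H i j x)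
        + 1 / 2 * (-(dlapReg ε x * x j) * u x + lapReg ε x * g j x))
      - 1 / 2 * ((-(regInv ε x ^ 3 * x j) * x j + regInv ε x) * (∑ i, g i x ^ 2)
        + regInv ε x * x j * (2 * ∑ i, g i x * H i j x))
      + 1 / 4 * ((-(ddlapReg ε x * x j) * x j + dlapReg ε x) * u x ^ 2
        + dlapReg ε x * x j * (2 * u x * g j x)))]
  · refine integral_congr_ae (Filter.Eventually.of_forall fun x => ?_)
    have hL := lapReg_eq hε x
    have hn := normSq_eq_sum x
    have hcross : ∑ j, g j x * (∑ i, x i * H i j x) = ∑ j, x j * (∑ i, g i x * H i j x) := by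
      simp only [Finset.mul_sum]
      rw [Finset.sum_comm]
      refine Finset.sum_congr rfl fun i _ => Finset.sum_congr rfl fun j _ => ?_
      rw [hsymm i j]; ring
    have hS : ∑ j, g j x * x j = ∑ i, x i * g i x :=
      Finset.sum_congr rfl fun i _ => mul_comm _ _
    have hQ : ∑ j, g j x * g j x = ∑ i, g i x ^ 2 :=
      Finset.sum_congr rfl fun i _ => (sq _).symm
    simp only [morMul, morForm]
    set S := ∑ i, x i * g i x
    set Q := ∑ i, g i x ^ 2
    have expand : ∀ j, H j j x * (regInv ε x * S + 1 / 2 * (lapReg ε x * u x))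
      + g j x * (-(regInv ε x ^ 3 * x j) * S
        + regInv ε x * (g j x + ∑ i, x i * H i j x)
        + 1 / 2 * (-(dlapReg ε x * x j) * u x + lapReg ε x * g j x))
      - 1 / 2 * ((-(regInv ε x ^ 3 * x j) * x j + regInv ε x) * Q
        + regInv ε x * x j * (2 * ∑ i, g i x * H i j x))
      + 1 / 4 * ((-(ddlapReg ε x * x j) * x j + dlapReg ε x) * u x ^ 2
        + dlapReg ε x * x j * (2 * u x * g j x))
      = (regInv ε x * S + 1 / 2 * (lapReg ε x * u x)) * H j j x
        + (-(regInv ε x ^ 3 * S)) * (g j x * x j)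
        + (regInv ε x + 1 / 2 * lapReg ε x) * (g j x * g j x)
        + regInv ε x * (g j x * (∑ i, x i * H i j x))
        - regInv ε x * (x j * (∑ i, g i x * H i j x))
        + (1 / 2 * regInv ε x ^ 3 * Q - 1 / 4 * ddlapReg ε x * u x ^ 2) * (x j * x j)
        + (1 / 4 * dlapReg ε x * u x ^ 2 - 1 / 2 * regInv ε x * Q) := fun j => by ring
    simp only [expand]
    simp only [Finset.sum_add_distrib, Finset.sum_sub_distrib, ← Finset.mul_sum, hcross, hS, hQ,
      ← hn, Finset.sum_const, Finset.card_univ, Fintype.card_fin, nsmul_eq_mul]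
    linear_combination (1 / 2 * Q) * hL
  · intro j; fun_prop
  · intro j; fun_prop
  · intro j x hx; simp [h0 x hx, g0 _ x hx]
  · intro j x
    have dφ : HasDerivAt _ _ _ := hasLineDerivAt_regInv hε x j
    have dL : HasDerivAt _ _ _ := hasLineDerivAt_lapReg hε x j
    have dm : HasDerivAt _ _ _ := hasLineDerivAt_dlapReg hε x j
    have du : HasDerivAt _ _ _ := hud j x
    have dg : HasDerivAt _ _ _ := hgd j j x
    have dx : HasDerivAt _ _ _ := hasDerivAt_coord_line x j j
    have dS : HasDerivAt _ _ _ := hasLineDerivAt_sum_coord_mul hgd x j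
    have dQ : HasDerivAt _ _ _ := hasLineDerivAt_sum_sq hgd x j
    have := ((dg.mul ((dφ.mul dS).add ((dL.mul du).const_mul (1 / 2)))).sub
      (((dφ.mul dx).mul dQ).const_mul (1 / 2))).add (((dm.mul dx).mul (du.pow 2)).const_mul (1 / 4))
    refine this.congr_deriv ?_
    simp

lemma integral_morMul_sq_le {d : ℕ} (hd : 5 ≤ d) {ε R : ℝ} (hε : 0 < ε)
    {u : Ed d → ℝ} {g : Fin d → Ed d → ℝ}
    (hu : Continuous u) (hg : ∀ i, Continuous (g i))
    (hud : ∀ j x, HasLineDerivAt ℝ u (g j x) x (EuclideanSpace.single j 1))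
    (h0 : ∀ x, R < ‖x‖ → u x = 0) :
    ∫ x, morMul ε u g x ^ 2 ≤ ∫ x, ∑ i, g i x ^ 2 := by
  have cφ := continuous_regInv (d := d) hε
  have cL := continuous_lapReg (d := d) hε
  have cm := continuous_dlapReg (d := d) hε
  have g0 : ∀ j x, R < ‖x‖ → g j x = 0 := fun j => zero_of_hasLineDerivAt h0 (hud j)
  have cc : ∀ j, Continuous fun x : Ed d => x j := fun j => by fun_prop
  have key := integral_sum_lineDeriv_eq_zero (R := R)
    (F := fun j x => 1 / 2 * (lapReg ε x * u x ^ 2 * (regInv ε x * x j)))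
    (F' := fun j x => 1 / 2 * ((-(dlapReg ε x * x j) * u x ^ 2 + lapReg ε x * (2 * u x * g j x))
      * (regInv ε x * x j) + lapReg ε x * u x ^ 2 * (-(regInv ε x ^ 3 * x j) * x j + regInv ε x)))
    (by intro j; fun_prop) (by intro j; fun_prop) (by intro j x hx; simp [h0 x hx])
    (by
      intro j x
      have dφ : HasDerivAt _ _ _ := hasLineDerivAt_regInv hε x j
      have dL : HasDerivAt _ _ _ := hasLineDerivAt_lapReg hε x j
      have du : HasDerivAt _ _ _ := hud j x
      have dx : HasDerivAt _ _ _ := hasDerivAt_coord_line x j j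
      refine (((dL.mul (du.pow 2)).mul (dφ.mul dx)).const_mul (1 / 2)).congr_deriv ?_
      simp)
  have hi1 : Integrable fun x => morMul ε u g x ^ 2 := by
    refine integrable_of_zero (R := R) (by unfold morMul; fun_prop) fun x hx => ?_
    simp [morMul, h0 x hx, g0 _ x hx]
  have hi2 : Integrable fun x => ∑ i, g i x ^ 2 := by
    refine integrable_of_zero (R := R) (by fun_prop) fun x hx => ?_
    simp [g0 _ x hx]
  rw [← sub_zero (∫ x, morMul ε u g x ^ 2), ← key, ← integral_sub hi1]
  · refine integral_mono (hi1.sub ?_) hi2 fun x => ?_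
    · refine integrable_of_zero (R := R) (by fun_prop) fun x hx => ?_
      simp [h0 x hx]
    have hL := lapReg_eq hε x
    have hn := normSq_eq_sum x
    have hcs : (∑ i, x i * g i x) ^ 2 ≤ ‖x‖ ^ 2 * ∑ i, g i x ^ 2 := by
      have := Finset.sum_mul_sq_le_sq_mul_sq Finset.univ (fun i => x i) (fun i => g i x)
      rw [hn]; simpa [sq] using this
    have hS : ∑ j, g j x * x j = ∑ i, x i * g i x :=
      Finset.sum_congr rfl fun i _ => mul_comm _ _
    simp only [morMul]
    set S := ∑ i, x i * g i x
    have hQ0 : 0 ≤ ∑ i, g i x ^ 2 := Finset.sum_nonneg fun i _ => sq_nonneg _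
    set Q := ∑ i, g i x ^ 2
    have expand : ∀ j, 1 / 2 * ((-(dlapReg ε x * x j) * u x ^ 2 + lapReg ε x * (2 * u x * g j x))
      * (regInv ε x * x j) + lapReg ε x * u x ^ 2 * (-(regInv ε x ^ 3 * x j) * x j + regInv ε x))
      = (-(1 / 2 * dlapReg ε x * u x ^ 2 * regInv ε x)
          - 1 / 2 * lapReg ε x * u x ^ 2 * regInv ε x ^ 3) * (x j * x j)
        + (lapReg ε x * u x * regInv ε x) * (g j x * x j)
        + 1 / 2 * lapReg ε x * u x ^ 2 * regInv ε x := fun j => by ring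
    simp only [expand]
    simp only [Finset.sum_add_distrib, ← Finset.mul_sum, hS,
      ← hn, Finset.sum_const, Finset.card_univ, Fintype.card_fin, nsmul_eq_mul]
    have h1 := regInv_mul_norm_le hε x
    have h2 := mul_le_mul_of_nonneg_right (lapReg_sq_ge hd hε x) (sq_nonneg (u x))
    have h3 : regInv ε x ^ 2 * S ^ 2 ≤ Q := by
      calc regInv ε x ^ 2 * S ^ 2 ≤ regInv ε x ^ 2 * (‖x‖ ^ 2 * Q) := by gcongr
        _ = (regInv ε x ^ 2 * ‖x‖ ^ 2) * Q := by ring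
        _ ≤ 1 * Q := by gcongr
        _ = Q := one_mul _
    have h4 : 1 / 2 * lapReg ε x * u x ^ 2 * (d * regInv ε x - regInv ε x ^ 3 * ‖x‖ ^ 2)
      = 1 / 2 * lapReg ε x * u x ^ 2 * lapReg ε x := by rw [hL]
    nlinarith
  · refine integrable_of_zero (R := R) (by fun_prop) fun x hx => ?_
    simp [h0 x hx]

lemma integral_mul_morMul_self {d : ℕ} {ε R : ℝ} (hε : 0 < ε)
    {u : Ed d → ℝ} {g : Fin d → Ed d → ℝ}
    (hu : Continuous u) (hg : ∀ i, Continuous (g i))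
    (hud : ∀ j x, HasLineDerivAt ℝ u (g j x) x (EuclideanSpace.single j 1))
    (h0 : ∀ x, R < ‖x‖ → u x = 0) :
    ∫ x, u x * morMul ε u g x = 0 := by
  have cφ := continuous_regInv (d := d) hε
  have cc : ∀ j, Continuous fun x : Ed d => x j := fun j => by fun_prop
  rw [← integral_sum_lineDeriv_eq_zero (R := R)
    (F := fun j x => 1 / 2 * (u x ^ 2 * (regInv ε x * x j)))
    (F' := fun j x => 1 / 2 * ((2 * u x * g j x) * (regInv ε x * x j)
      + u x ^ 2 * (-(regInv ε x ^ 3 * x j) * x j + regInv ε x)))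
    (by intro j; fun_prop) (by intro j; fun_prop) (by intro j x hx; simp [h0 x hx])
    (by
      intro j x
      have dφ : HasDerivAt _ _ _ := hasLineDerivAt_regInv hε x j
      have du : HasDerivAt _ _ _ := hud j x
      have dx : HasDerivAt _ _ _ := hasDerivAt_coord_line x j j
      refine (((du.pow 2).mul (dφ.mul dx)).const_mul (1 / 2)).congr_deriv ?_
      simp)]
  refine integral_congr_ae (Filter.Eventually.of_forall fun x => ?_)
  have hL := lapReg_eq hε x
  have hn := normSq_eq_sum x
  have hS : ∑ j, g j x * x j = ∑ i, x i * g i x :=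
    Finset.sum_congr rfl fun i _ => mul_comm _ _
  simp only [morMul]
  set S := ∑ i, x i * g i x
  have expand : ∀ j, 1 / 2 * ((2 * u x * g j x) * (regInv ε x * x j)
      + u x ^ 2 * (-(regInv ε x ^ 3 * x j) * x j + regInv ε x))
      = (u x * regInv ε x) * (g j x * x j) - (1 / 2 * u x ^ 2 * regInv ε x ^ 3) * (x j * x j)
        + 1 / 2 * u x ^ 2 * regInv ε x := fun j => by ring
  simp only [expand]
  simp only [Finset.sum_add_distrib, Finset.sum_sub_distrib, ← Finset.mul_sum, hS,
      ← hn, Finset.sum_const, Finset.card_univ, Fintype.card_fin, nsmul_eq_mul]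
  linear_combination (-(1 / 2 * u x ^ 2)) * hL

lemma morForm_ge {d : ℕ} (hd : 5 ≤ d) {ε : ℝ} (hε : 0 < ε)
    (u : Ed d → ℝ) (g : Fin d → Ed d → ℝ) (x : Ed d) :
    regInv ε x * (∑ i, g i x ^ 2) - regInv ε x ^ 3 * (∑ i, x i * g i x) ^ 2
      + regInv ε x ^ 3 * u x ^ 2 ≤ morForm ε u g x := by
  have h := mul_le_mul_of_nonneg_right (bilap_ge hd hε x) (sq_nonneg (u x))
  have h' : 0 ≤ regInv ε x ^ 3 * u x ^ 2 := by
    have := regInv_pos hε x; positivity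
  unfold morForm
  linarith

lemma morForm_nonneg {d : ℕ} (hd : 5 ≤ d) {ε : ℝ} (hε : 0 < ε)
    (u : Ed d → ℝ) (g : Fin d → Ed d → ℝ) (x : Ed d) : 0 ≤ morForm ε u g x := by
  refine le_trans ?_ (morForm_ge hd hε u g x)
  have hp := regInv_pos hε x
  have hcs : (∑ i, x i * g i x) ^ 2 ≤ ‖x‖ ^ 2 * ∑ i, g i x ^ 2 := by
    have := Finset.sum_mul_sq_le_sq_mul_sq Finset.univ (fun i => x i) (fun i => g i x)
    rw [normSq_eq_sum]; simpa [sq] using this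
  have hQ0 : 0 ≤ ∑ i, g i x ^ 2 := Finset.sum_nonneg fun i _ => sq_nonneg _
  set S := ∑ i, x i * g i x
  set Q := ∑ i, g i x ^ 2
  have h3 : regInv ε x ^ 3 * S ^ 2 ≤ regInv ε x * Q := by
    calc regInv ε x ^ 3 * S ^ 2 ≤ regInv ε x ^ 3 * (‖x‖ ^ 2 * Q) := by gcongr
      _ = regInv ε x * ((regInv ε x ^ 2 * ‖x‖ ^ 2) * Q) := by ring
      _ ≤ regInv ε x * (1 * Q) := by gcongr; exact regInv_mul_norm_le hε x
      _ = regInv ε x * Q := by ring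
  have : 0 ≤ regInv ε x ^ 3 * u x ^ 2 := by positivity
  linarith

lemma integrableOn_inv_norm_pow_four {d : ℕ} (hd : 5 ≤ d) (r : ℝ) :
    IntegrableOn (fun z : Ed d => (‖z‖ ^ 4)⁻¹) (Metric.ball 0 r) := by
  have : Nonempty (Fin d) := ⟨⟨0, by omega⟩⟩
  have : Nontrivial (Ed d) := inferInstance
  rw [integrableOn_fun_norm_addHaar volume (f := fun t : ℝ => (t ^ 4)⁻¹)]
  rw [finrank_euclideanSpace_fin]
  have h : IntegrableOn (fun t : ℝ => t ^ (d - 5)) (Set.Ioo 0 r) :=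
    ((by fun_prop : Continuous fun t : ℝ => t ^ (d - 5)).integrableOn_Icc).mono_set
      Set.Ioo_subset_Icc_self
  refine h.congr_fun (fun t ht => ?_) measurableSet_Ioo
  have ht0 : t ≠ 0 := ht.1.ne'
  obtain ⟨k, rfl⟩ := Nat.exists_eq_add_of_le hd
  have : 5 + k - 1 = k + 4 := by omega
  simp only [this, smul_eq_mul, pow_add]
  field_simp
  congr 1; omega

lemma integrable_hartree {d : ℕ} (hd : 5 ≤ d) {u : Ed d → ℝ} {R : ℝ} (hu : Continuous u)
    (h0 : ∀ x, R < ‖x‖ → u x = 0) (x : Ed d) :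
    Integrable fun y : Ed d => (u y) ^ 2 / ‖x - y‖ ^ 4 := by
  obtain ⟨B, hB⟩ := hu.bounded_above_of_compact_support (hasCompactSupport_of_zero h0)
  have h1 : Integrable (Set.indicator (Metric.ball (0 : Ed d) (‖x‖ + R + 1))
      fun z : Ed d => (‖z‖ ^ 4)⁻¹) :=
    (integrable_indicator_iff measurableSet_ball).2 (integrableOn_inv_norm_pow_four hd _)
  have h2 := (h1.comp_sub_left x).const_mul (B ^ 2)
  refine h2.mono' ?_ (Filter.Eventually.of_forall fun y => ?_)
  · exact (Measurable.aestronglyMeasurable (by fun_prop))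
  · rw [Real.norm_of_nonneg (by positivity)]
    by_cases hy : R < ‖y‖
    · rw [h0 y hy]
      simp only [ne_eq, OfNat.ofNat_ne_zero, not_false_eq_true, zero_pow, zero_div]
      exact mul_nonneg (sq_nonneg _) (Set.indicator_nonneg (fun z _ => by positivity) _)
    · rw [Set.indicator_of_mem, div_eq_mul_inv]
      · have : u y ^ 2 ≤ B ^ 2 := by
          rw [← sq_abs (u y)]
          exact pow_le_pow_left₀ (abs_nonneg _) (hB y) 2
        gcongr
      · rw [mem_ball_zero_iff]
        have := norm_sub_le x y
        linarith

/-- The regularized kernel `(|z|² + δ)⁻²`. -/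
def regKer {d : ℕ} (δ : ℝ) (z : Ed d) : ℝ := ((‖z‖ ^ 2 + δ) ^ 2)⁻¹

lemma continuous_regKer {d : ℕ} {δ : ℝ} (hδ : 0 < δ) : Continuous (regKer (d := d) δ) := by
  unfold regKer
  refine Continuous.inv₀ (by fun_prop) fun x => ?_
  positivity

lemma hasLineDerivAt_regKer {d : ℕ} {δ : ℝ} (hδ : 0 < δ) (x y : Ed d) (j : Fin d) :
    HasLineDerivAt ℝ (fun x => regKer δ (x - y))
      (-(4 * ((‖x - y‖ ^ 2 + δ) ^ 3)⁻¹ * (x - y) j)) x (EuclideanSpace.single j 1) := by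
  have h := (((hasDerivAt_normSq_line (x - y) j).add_const δ).pow 2).inv (by simp; positivity)
  have e : (fun t : ℝ => regKer δ (x + t • EuclideanSpace.single j 1 - y))
      = fun t : ℝ => ((‖x - y + t • EuclideanSpace.single j 1‖ ^ 2 + δ) ^ 2)⁻¹ := by
    funext t
    unfold regKer
    rw [add_sub_right_comm]
  unfold HasLineDerivAt
  rw [e]
  refine h.congr_deriv ?_
  have : 0 < ‖x - y‖ ^ 2 + δ := by positivity
  simp only [zero_smul, add_zero]
  simp
  field_simp
  ring

lemma inner_sub_regInv_nonneg {d : ℕ} {ε : ℝ} (hε : 0 < ε) (x y : Ed d) :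
    0 ≤ ⟪x - y, regInv ε x • x - regInv ε y • y⟫ := by
  have hx := regInv_pos hε x
  have hy := regInv_pos hε y
  have e : ⟪x - y, regInv ε x • x - regInv ε y • y⟫ = regInv ε x * ‖x‖ ^ 2 + regInv ε y * ‖y‖ ^ 2
      - (regInv ε x + regInv ε y) * ⟪x, y⟫ := by
    simp only [inner_sub_left, inner_sub_right, inner_smul_right, real_inner_self_eq_norm_sq,
      real_inner_comm x y]
    ring
  rw [e]
  have hxy := real_inner_le_norm x y
  have h1 : (regInv ε x + regInv ε y) * ⟪x, y⟫ ≤ (regInv ε x + regInv ε y) * (‖x‖ * ‖y‖) := by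
    gcongr
  have hmono : ∀ a b : Ed d, ‖b‖ ≤ ‖a‖ → regInv ε b * ‖b‖ ≤ regInv ε a * ‖a‖ := by
    intro a b hab
    have ha := regInv_sq hε a
    have hb := regInv_sq hε b
    have pa := regInv_pos hε a
    have pb := regInv_pos hε b
    refine abs_le_of_sq_le_sq' ?_ (by positivity) |>.2
    have hba : regInv ε a ≤ regInv ε b := by
      unfold regInv
      gcongr
    have h2 : regInv ε a ^ 2 * ε ^ 2 ≤ regInv ε b ^ 2 * ε ^ 2 := by gcongr
    nlinarith
  have h2 : 0 ≤ (‖x‖ - ‖y‖) * (regInv ε x * ‖x‖ - regInv ε y * ‖y‖) := by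
    rcases le_total ‖x‖ ‖y‖ with h | h
    · exact mul_nonneg_of_nonpos_of_nonpos (by linarith) (by linarith [hmono y x h])
    · exact mul_nonneg (by linarith) (by linarith [hmono x y h])
  nlinarith

lemma integral_regKer_mul {d : ℕ} {ε R δ : ℝ} (hε : 0 < ε) (hδ : 0 < δ)
    {u : Ed d → ℝ} {g : Fin d → Ed d → ℝ}
    (hu : Continuous u) (hg : ∀ i, Continuous (g i))
    (hud : ∀ j x, HasLineDerivAt ℝ u (g j x) x (EuclideanSpace.single j 1))
    (h0 : ∀ x, R < ‖x‖ → u x = 0) (y : Ed d) :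
    ∫ x, regKer δ (x - y) * (2 * u x * morMul ε u g x)
      = ∫ x, 4 * ((‖x - y‖ ^ 2 + δ) ^ 3)⁻¹ * ⟪x - y, regInv ε x • x⟫ * u x ^ 2 := by
  have cφ := continuous_regInv (d := d) hε
  have cL := continuous_lapReg (d := d) hε
  have ck := continuous_regKer (d := d) hδ
  have ck3 : Continuous fun x : Ed d => ((‖x - y‖ ^ 2 + δ) ^ 3)⁻¹ :=
    Continuous.inv₀ (by fun_prop) fun x => by positivity
  have cc : ∀ j, Continuous fun x : Ed d => x j := fun j => by fun_prop
  have cc' : ∀ j, Continuous fun x : Ed d => (x - y) j := fun j => by fun_prop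
  have g0 : ∀ j x, R < ‖x‖ → g j x = 0 := fun j => zero_of_hasLineDerivAt h0 (hud j)
  rw [← sub_eq_zero, ← integral_sub]
  · rw [← integral_sum_lineDeriv_eq_zero (R := R)
      (F := fun j x => regKer δ (x - y) * (u x ^ 2 * (regInv ε x * x j)))
      (F' := fun j x => -(4 * ((‖x - y‖ ^ 2 + δ) ^ 3)⁻¹ * (x - y) j)
        * (u x ^ 2 * (regInv ε x * x j)) + regKer δ (x - y) * ((2 * u x * g j x) * (regInv ε x * x j)
        + u x ^ 2 * (-(regInv ε x ^ 3 * x j) * x j + regInv ε x)))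
      (by intro j; fun_prop) (by intro j; fun_prop) (by intro j x hx; simp [h0 x hx])
      (by
        intro j x
        have dφ : HasDerivAt _ _ _ := hasLineDerivAt_regInv hε x j
        have du : HasDerivAt _ _ _ := hud j x
        have dx : HasDerivAt _ _ _ := hasDerivAt_coord_line x j j
        have dk : HasDerivAt _ _ _ := hasLineDerivAt_regKer hδ x y j
        refine (dk.mul ((du.pow 2).mul (dφ.mul dx))).congr_deriv ?_
        simp)]
    refine integral_congr_ae (Filter.Eventually.of_forall fun x => ?_)
    have hL := lapReg_eq hε x
    have hn := normSq_eq_sum x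
    have hS : ∑ j, g j x * x j = ∑ i, x i * g i x :=
      Finset.sum_congr rfl fun i _ => mul_comm _ _
    have hI : ⟪x - y, regInv ε x • x⟫ = regInv ε x * ∑ j, (x - y) j * x j := by
      rw [inner_smul_right, PiLp.inner_apply]
      congr 1
      exact Finset.sum_congr rfl fun i _ => by simp; ring
    simp only [morMul]
    rw [hI]
    set S := ∑ i, x i * g i x
    have expand : ∀ j, -(4 * ((‖x - y‖ ^ 2 + δ) ^ 3)⁻¹ * (x - y) j)
        * (u x ^ 2 * (regInv ε x * x j)) + regKer δ (x - y) * ((2 * u x * g j x) * (regInv ε x * x j)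
        + u x ^ 2 * (-(regInv ε x ^ 3 * x j) * x j + regInv ε x))
        = -(4 * ((‖x - y‖ ^ 2 + δ) ^ 3)⁻¹ * u x ^ 2 * regInv ε x) * ((x - y) j * x j)
        + (regKer δ (x - y) * 2 * u x * regInv ε x) * (g j x * x j)
        - (regKer δ (x - y) * u x ^ 2 * regInv ε x ^ 3) * (x j * x j)
        + regKer δ (x - y) * u x ^ 2 * regInv ε x := fun j => by ring
    simp only [expand]
    simp only [Finset.sum_add_distrib, Finset.sum_sub_distrib, ← Finset.mul_sum, hS,
      ← hn, Finset.sum_const, Finset.card_univ, Fintype.card_fin, nsmul_eq_mul]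
    linear_combination (-(regKer δ (x - y) * u x ^ 2)) * hL
  · refine integrable_of_zero (R := R) (by unfold morMul; fun_prop) fun x hx => ?_
    simp [h0 x hx]
  · refine integrable_of_zero (R := R) (by fun_prop) fun x hx => ?_
    simp [h0 x hx]

lemma integrable_prod_of_zero {d : ℕ} {F : Ed d × Ed d → ℝ} {R : ℝ} (hF : Continuous F)
    (h1 : ∀ p : Ed d × Ed d, R < ‖p.1‖ → F p = 0) (h2 : ∀ p : Ed d × Ed d, R < ‖p.2‖ → F p = 0) :
    Integrable F (volume.prod volume) := by
  refine hF.integrable_of_hasCompactSupport (HasCompactSupport.intro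
    ((isCompact_closedBall (0 : Ed d) R).prod (isCompact_closedBall (0 : Ed d) R)) fun p hp => ?_)
  by_contra hne
  refine hp ⟨?_, ?_⟩
  · simpa using not_lt.1 fun h => hne (h1 p h)
  · simpa using not_lt.1 fun h => hne (h2 p h)

lemma regularized_hartree_nonneg {d : ℕ} {ε R δ : ℝ} (hε : 0 < ε) (hδ : 0 < δ)
    {u : Ed d → ℝ} {g : Fin d → Ed d → ℝ}
    (hu : Continuous u) (hg : ∀ i, Continuous (g i))
    (hud : ∀ j x, HasLineDerivAt ℝ u (g j x) x (EuclideanSpace.single j 1))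
    (h0 : ∀ x, R < ‖x‖ → u x = 0) :
    0 ≤ ∫ x, (∫ y, regKer δ (x - y) * u y ^ 2) * (2 * u x * morMul ε u g x) := by
  have cφ := continuous_regInv (d := d) hε
  have cL := continuous_lapReg (d := d) hε
  have ck := continuous_regKer (d := d) hδ
  have ck3 : Continuous fun p : Ed d × Ed d => ((‖p.1 - p.2‖ ^ 2 + δ) ^ 3)⁻¹ :=
    Continuous.inv₀ (by fun_prop) fun x => by positivity
  have cc : ∀ j, Continuous fun x : Ed d => x j := fun j => by fun_prop
  have i1 : Integrable (fun p : Ed d × Ed d =>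
      regKer δ (p.1 - p.2) * u p.2 ^ 2 * (2 * u p.1 * morMul ε u g p.1)) (volume.prod volume) := by
    refine integrable_prod_of_zero (R := R) (by unfold morMul; fun_prop) (fun p hp => ?_)
      fun p hp => ?_
    · simp [h0 _ hp]
    · simp [h0 _ hp]
  let G : Ed d × Ed d → ℝ := fun p =>
    4 * ((‖p.1 - p.2‖ ^ 2 + δ) ^ 3)⁻¹ * ⟪p.1 - p.2, regInv ε p.1 • p.1⟫ * u p.1 ^ 2 * u p.2 ^ 2
  have i2 : Integrable G (volume.prod volume) := by
    refine integrable_prod_of_zero (R := R) (by fun_prop) (fun p hp => ?_) fun p hp => ?_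
    · simp [G, h0 _ hp]
    · simp [G, h0 _ hp]
  have e1 : ∫ x, (∫ y, regKer δ (x - y) * u y ^ 2) * (2 * u x * morMul ε u g x)
      = ∫ p, G p ∂(volume.prod volume) := by
    rw [integral_prod_symm _ i2]
    have : ∀ y, ∫ x, G (x, y) = ∫ x, regKer δ (x - y) * u y ^ 2 * (2 * u x * morMul ε u g x) := by
      intro y
      have := integral_regKer_mul hε hδ hu hg hud h0 y
      simp only [G]
      rw [integral_mul_const, ← this, ← integral_mul_const]
      exact integral_congr_ae (Filter.Eventually.of_forall fun x => by simp only; ring)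
    simp only [this]
    rw [← integral_prod_symm _ i1, integral_prod _ i1]
    exact integral_congr_ae (Filter.Eventually.of_forall fun x => by
      simp only; rw [integral_mul_const])
  have e2 : ∫ p, G p ∂(volume.prod volume) = ∫ p, G p.swap ∂(volume.prod volume) :=
    (integral_prod_swap G).symm
  have e3 : 0 ≤ ∫ p, G p + G p.swap ∂(volume.prod volume) := by
    refine integral_nonneg fun p => ?_
    have : G p + G p.swap = 4 * ((‖p.1 - p.2‖ ^ 2 + δ) ^ 3)⁻¹
        * ⟪p.1 - p.2, regInv ε p.1 • p.1 - regInv ε p.2 • p.2⟫ * u p.1 ^ 2 * u p.2 ^ 2 := by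
      simp only [G, Prod.fst_swap, Prod.snd_swap]
      rw [norm_sub_rev p.2 p.1, ← neg_sub p.1 p.2, inner_neg_left, inner_sub_right]
      ring
    simp only [Pi.zero_apply, this]
    have := inner_sub_regInv_nonneg hε p.1 p.2
    positivity
  have e4 : ∫ p, G p + G p.swap ∂(volume.prod volume)
      = ∫ p, G p ∂(volume.prod volume) + ∫ p, G p.swap ∂(volume.prod volume) :=
    integral_add i2 i2.swap
  rw [e1]; linarith

lemma hartree_morMul_nonneg {d : ℕ} (hd : 5 ≤ d) {ε R : ℝ} (hε : 0 < ε)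
    {u : Ed d → ℝ} {g : Fin d → Ed d → ℝ}
    (hu : Continuous u) (hg : ∀ i, Continuous (g i))
    (hud : ∀ j x, HasLineDerivAt ℝ u (g j x) x (EuclideanSpace.single j 1))
    (h0 : ∀ x, R < ‖x‖ → u x = 0) (hV : Continuous fun x => hartreePot u x * u x) :
    0 ≤ ∫ x, hartreePot u x * u x * morMul ε u g x := by
  have cφ := continuous_regInv (d := d) hε
  have cL := continuous_lapReg (d := d) hε
  have cc : ∀ j, Continuous fun x : Ed d => x j := fun j => by fun_prop
  have cX : Continuous (morMul ε u g) := by unfold morMul; fun_prop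
  have hδ : ∀ n : ℕ, (0 : ℝ) < 1 / ((n : ℝ) + 1) := fun n => by positivity
  have lim0 := tendsto_one_div_add_atTop_nhds_zero_nat (𝕜 := ℝ)
  have hle : ∀ (n : ℕ) (x y : Ed d), y ≠ x →
      regKer (1 / ((n : ℝ) + 1)) (x - y) * u y ^ 2 ≤ u y ^ 2 / ‖x - y‖ ^ 4 := by
    intro n x y hxy
    have : 0 < ‖x - y‖ := norm_pos_iff.2 (sub_ne_zero.2 hxy.symm)
    rw [div_eq_inv_mul (u y ^ 2)]
    unfold regKer
    gcongr
    calc ‖x - y‖ ^ 4 = (‖x - y‖ ^ 2) ^ 2 := by ring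
      _ ≤ (‖x - y‖ ^ 2 + 1 / ((n : ℝ) + 1)) ^ 2 :=
        pow_le_pow_left₀ (by positivity) (by linarith [hδ n]) 2
  have hne : ∀ x : Ed d, ∀ᵐ y : Ed d, y ≠ x := by
    intro x
    have : Nonempty (Fin d) := ⟨⟨0, by omega⟩⟩
    have : Nontrivial (Ed d) := inferInstance
    exact Measure.ae_ne volume x
  have hk0 : ∀ (n : ℕ) (z : Ed d), 0 ≤ regKer (1 / ((n : ℝ) + 1)) z := fun n z => by
    unfold regKer; positivity
  have hlim : ∀ x : Ed d, Filter.Tendsto (fun n : ℕ => ∫ y, regKer (1 / ((n : ℝ) + 1)) (x - y)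
      * u y ^ 2) Filter.atTop (nhds (hartreePot u x)) := by
    intro x
    refine tendsto_integral_of_dominated_convergence (fun y => u y ^ 2 / ‖x - y‖ ^ 4)
      (fun n => ?_) (integrable_hartree hd hu h0 x) (fun n => ?_) ?_
    · have := continuous_regKer (d := d) (hδ n)
      exact Continuous.aestronglyMeasurable (by fun_prop)
    · filter_upwards [hne x] with y hy
      rw [Real.norm_of_nonneg (mul_nonneg (hk0 n _) (sq_nonneg _))]
      exact hle n x y hy
    · filter_upwards [hne x] with y hy
      have : 0 < ‖x - y‖ := norm_pos_iff.2 (sub_ne_zero.2 hy.symm)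
      have h1 : Filter.Tendsto (fun n : ℕ => ((‖x - y‖ ^ 2 + 1 / ((n : ℝ) + 1)) ^ 2)⁻¹ * u y ^ 2)
          Filter.atTop (nhds (((‖x - y‖ ^ 2 + 0) ^ 2)⁻¹ * u y ^ 2)) :=
        (((lim0.const_add _).pow 2).inv₀ (by positivity)).mul_const _
      have e : u y ^ 2 / ‖x - y‖ ^ 4 = ((‖x - y‖ ^ 2 + 0) ^ 2)⁻¹ * u y ^ 2 := by
        rw [add_zero, ← pow_mul, div_eq_inv_mul]
      rw [e]
      exact h1
  have hlim2 : Filter.Tendsto (fun n : ℕ => ∫ x, (∫ y, regKer (1 / ((n : ℝ) + 1)) (x - y) * u y ^ 2)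
      * (2 * u x * morMul ε u g x)) Filter.atTop
      (nhds (∫ x, hartreePot u x * (2 * u x * morMul ε u g x))) := by
    refine tendsto_integral_of_dominated_convergence
      (fun x => |hartreePot u x * u x * (2 * morMul ε u g x)|) (fun n => ?_) ?_ (fun n => ?_) ?_
    · have ck := continuous_regKer (d := d) (hδ n)
      refine AEStronglyMeasurable.mul ?_ (Continuous.aestronglyMeasurable (by fun_prop))
      have : StronglyMeasurable (Function.uncurry fun (x y : Ed d) =>
          regKer (1 / ((n : ℝ) + 1)) (x - y) * u y ^ 2) :=
        Continuous.stronglyMeasurable (by fun_prop)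
      exact this.integral_prod_right.aestronglyMeasurable
    · refine (integrable_of_zero (R := R) (by fun_prop) fun x hx => ?_).abs
      simp [h0 x hx]
    · refine Filter.Eventually.of_forall fun x => ?_
      have h1 : 0 ≤ ∫ y, regKer (1 / ((n : ℝ) + 1)) (x - y) * u y ^ 2 :=
        integral_nonneg fun y => mul_nonneg (hk0 n _) (sq_nonneg _)
      have h2 : ∫ y, regKer (1 / ((n : ℝ) + 1)) (x - y) * u y ^ 2 ≤ hartreePot u x := by
        refine integral_mono_of_nonneg
          (Filter.Eventually.of_forall fun y => mul_nonneg (hk0 n _) (sq_nonneg _))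
          (integrable_hartree hd hu h0 x) ?_
        filter_upwards [hne x] with y hy using hle n x y hy
      rw [Real.norm_eq_abs, abs_mul, abs_of_nonneg h1]
      have : |hartreePot u x * u x * (2 * morMul ε u g x)|
        = hartreePot u x * |2 * u x * morMul ε u g x| := by
        rw [← abs_of_nonneg (h1.trans h2), ← abs_mul, abs_of_nonneg (h1.trans h2)]
        ring_nf
      rw [this]
      gcongr
    · exact Filter.Eventually.of_forall fun x => (hlim x).mul_const _
  have h3 := ge_of_tendsto' hlim2 fun n =>
    regularized_hartree_nonneg hε (hδ n) hu hg hud h0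
  have h4 : ∫ x, hartreePot u x * (2 * u x * morMul ε u g x)
      = 2 * ∫ x, hartreePot u x * u x * morMul ε u g x := by
    rw [← integral_const_mul]
    exact integral_congr_ae (Filter.Eventually.of_forall fun x => by simp only; ring)
  linarith

lemma hasLineDerivAt_slice {d : ℕ} {F : ℝ × Ed d → ℝ} (hF : Differentiable ℝ F) (t : ℝ)
    (x w : Ed d) : HasLineDerivAt ℝ (fun x => F (t, x)) (fderiv ℝ F (t, x) (0, w)) x w := by
  have h1 : HasFDerivAt (fun x : Ed d => (t, x)) (ContinuousLinearMap.inr ℝ ℝ (Ed d)) x :=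
    hasFDerivAt_prodMk_right t x
  have h2 := ((hF (t, x)).hasFDerivAt.comp x h1).hasLineDerivAt w
  simpa [Function.comp_def] using h2

lemma hasDerivAt_time_slice {d : ℕ} {F : ℝ × Ed d → ℝ} (hF : Differentiable ℝ F) (t : ℝ)
    (x : Ed d) : HasDerivAt (fun s => F (s, x)) (fderiv ℝ F (t, x) (1, 0)) t := by
  have h1 : HasFDerivAt (fun s : ℝ => (s, x)) (ContinuousLinearMap.inl ℝ ℝ (Ed d)) t :=
    hasFDerivAt_prodMk_left t x
  have h2 := ((hF (t, x)).hasFDerivAt.comp t h1).hasDerivAt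
  simpa [Function.comp_def] using h2

/-- The spatial partial derivative `∂ⱼ u(t,x)`. -/
def spaceDeriv {d : ℕ} (u : ℝ → Ed d → ℝ) (t : ℝ) (j : Fin d) (x : Ed d) : ℝ :=
  fderiv ℝ (fun p : ℝ × Ed d => u p.1 p.2) (t, x) (0, EuclideanSpace.single j 1)

lemma gradient_apply_eq_spaceDeriv {d : ℕ} {u : ℝ → Ed d → ℝ}
    (hu : Differentiable ℝ (fun p : ℝ × Ed d => u p.1 p.2)) (t : ℝ) (x : Ed d) (j : Fin d) :
    gradient (u t) x j = spaceDeriv u t j x := by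
  have h1 : HasFDerivAt (fun x : Ed d => (t, x)) (ContinuousLinearMap.inr ℝ ℝ (Ed d)) x :=
    hasFDerivAt_prodMk_right t x
  have hd : DifferentiableAt ℝ (u t) x := (hu (t, x)).comp x h1.differentiableAt
  have h2 : HasLineDerivAt ℝ (u t) (spaceDeriv u t j x) x (EuclideanSpace.single j 1) :=
    hasLineDerivAt_slice hu t x _
  have h3 := hd.hasFDerivAt.hasLineDerivAt (EuclideanSpace.single j (1 : ℝ))
  rw [← h3.unique h2]
  have h4 : ⟪gradient (u t) x, EuclideanSpace.single j (1 : ℝ)⟫ = gradient (u t) x j := by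
    rw [EuclideanSpace.inner_single_right]; simp
  rw [← h4, gradient, InnerProductSpace.toDual_symm_apply]

lemma integrable_slab_of_zero {d : ℕ} {F : ℝ × Ed d → ℝ} {a b R : ℝ} (hF : Continuous F)
    (h0 : ∀ t ∈ Set.Icc a b, ∀ x, R < ‖x‖ → F (t, x) = 0) :
    Integrable F ((volume.restrict (Set.Icc a b)).prod volume) := by
  have h1 : IntegrableOn F (Set.Icc a b ×ˢ Metric.closedBall (0 : Ed d) R)
      (volume.prod volume) :=
    hF.continuousOn.integrableOn_compact (isCompact_Icc.prod (isCompact_closedBall _ _))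
  have h2 : IntegrableOn F (Set.Icc a b ×ˢ Set.univ) (volume.prod volume) := by
    refine h1.of_forall_sdiff_eq_zero (measurableSet_Icc.prod MeasurableSet.univ) fun p hp => ?_
    obtain ⟨⟨hp1, -⟩, hp2⟩ := hp
    refine h0 p.1 hp1 p.2 ?_
    by_contra hle
    exact hp2 ⟨hp1, by simpa using hle⟩
  rw [IntegrableOn, ← Measure.prod_restrict, Measure.restrict_univ] at h2
  exact h2

lemma lintegral_morForm_le {d : ℕ} (hd : 5 ≤ d) {a b R ε : ℝ} (hab : a < b) (hε : 0 < ε)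
    {u : ℝ → Ed d → ℝ} (hsol : IsWaveHartreeSol (Set.Icc a b) u)
    (h0 : ∀ t ∈ Set.Icc a b, ∀ x : Ed d, R ≤ ‖x‖ → u t x = 0) {M : ℝ≥0∞} (hM : M < ⊤)
    (hE : ∀ t ∈ Set.Icc a b, ∫⁻ x : Ed d,
      ENNReal.ofReal (‖gradient (u t) x‖ ^ 2 + (timeDeriv u t x) ^ 2) ≤ M) :
    ∫⁻ p : ℝ × Ed d, ENNReal.ofReal (morForm ε (u p.1) (spaceDeriv u p.1) p.2)
      ∂((volume.restrict (Set.Icc a b)).prod volume) ≤ M := by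
  obtain ⟨hU, hpde⟩ := hsol
  set U : ℝ × Ed d → ℝ := fun p => u p.1 p.2 with hUdef
  have cφ := continuous_regInv (d := d) hε
  have cL := continuous_lapReg (d := d) hε
  have cm := continuous_dlapReg (d := d) hε
  have ck := continuous_ddlapReg (d := d) hε
  have cc : ∀ j, Continuous fun x : Ed d => x j := fun j => by fun_prop
  have dU : Differentiable ℝ U := hU.differentiable (by norm_num)
  have hfd : ContDiff ℝ 1 (fderiv ℝ U) := hU.fderiv_right (by norm_num)
  let D : ℝ × Ed d → ℝ × Ed d → ℝ := fun v p => fderiv ℝ U p v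
  have cD : ∀ v, ContDiff ℝ 1 (D v) := fun v => hfd.clm_apply contDiff_const
  have dD : ∀ v, Differentiable ℝ (D v) := fun v => (cD v).differentiable (by norm_num)
  let DD : ℝ × Ed d → ℝ × Ed d → ℝ × Ed d → ℝ := fun v w p => fderiv ℝ (D v) p w
  have cDD : ∀ v w, Continuous (DD v w) := fun v w =>
    ((cD v).continuous_fderiv (by norm_num)).clm_apply continuous_const
  have hDD : ∀ v w p, DD v w p = fderiv ℝ (fderiv ℝ U) p w v := by
    intro v w p
    have h1 : HasFDerivAt (fderiv ℝ U) (fderiv ℝ (fderiv ℝ U) p) p :=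
      ((hfd.differentiable (by norm_num)) p).hasFDerivAt
    have h2 := h1.clm_apply (hasFDerivAt_const v p)
    simp only [DD, D]
    rw [h2.fderiv]
    simp
  have hsymm : ∀ v w p, DD v w p = DD w v p := by
    intro v w p
    rw [hDD, hDD]
    exact (hU.contDiffAt.isSymmSndFDerivAt (by simp)) w v
  let e : Fin d → ℝ × Ed d := fun j => (0, EuclideanSpace.single j 1)
  let e0 : ℝ × Ed d := (1, 0)
  have hg_eq : ∀ t j x, spaceDeriv u t j x = D (e j) (t, x) := fun t j x => rfl
  have htd : ∀ t x, timeDeriv u t x = D e0 (t, x) := fun t x =>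
    (hasDerivAt_time_slice dU t x).deriv
  have hgrad : ∀ t x, ‖gradient (u t) x‖ ^ 2 = ∑ j, spaceDeriv u t j x ^ 2 := by
    intro t x
    rw [EuclideanSpace.norm_sq_eq]
    exact Finset.sum_congr rfl fun j _ => by
      rw [gradient_apply_eq_spaceDeriv dU, Real.norm_eq_abs, sq_abs]
  have htt : ∀ t x, iteratedDeriv 2 (fun s => u s x) t = DD e0 e0 (t, x) := by
    intro t x
    rw [iteratedDeriv_succ, iteratedDeriv_one]
    have : deriv (fun s => u s x) = fun s => D e0 (s, x) :=
      funext fun s => (hasDerivAt_time_slice dU s x).deriv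
    rw [this]
    exact (hasDerivAt_time_slice (dD e0) t x).deriv
  have hud : ∀ t j x, HasLineDerivAt ℝ (u t) (spaceDeriv u t j x) x (EuclideanSpace.single j 1) :=
    fun t j x => hasLineDerivAt_slice dU t x _
  have hgd : ∀ t i j x, HasLineDerivAt ℝ (spaceDeriv u t i) (DD (e i) (e j) (t, x)) x
      (EuclideanSpace.single j 1) := fun t i j x => hasLineDerivAt_slice (dD (e i)) t x _
  have hwd : ∀ t j x, HasLineDerivAt ℝ (fun x => D e0 (t, x)) (DD e0 (e j) (t, x)) x
      (EuclideanSpace.single j 1) := fun t j x => hasLineDerivAt_slice (dD e0) t x _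
  have hlap : ∀ t x, spaceLaplacian (u t) x = ∑ j, DD (e j) (e j) (t, x) := by
    intro t x
    unfold spaceLaplacian
    refine Finset.sum_congr rfl fun j _ => ?_
    have key : ∀ (F F' : Ed d → ℝ) (_ : ∀ y, HasLineDerivAt ℝ F (F' y) y
        (EuclideanSpace.single j 1)) (s : ℝ),
        deriv (fun s : ℝ => F (x + s • EuclideanSpace.single j 1)) s
          = F' (x + s • EuclideanSpace.single j 1) := by
      intro F F' hF s
      have h1 : HasDerivAt (fun r : ℝ => F (x + s • EuclideanSpace.single j 1
          + r • EuclideanSpace.single j 1)) _ 0 := hF (x + s • EuclideanSpace.single j 1)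
      have h2 : HasDerivAt (fun r : ℝ => F (x + s • EuclideanSpace.single j 1
          + (r - s) • EuclideanSpace.single j 1)) (F' (x + s • EuclideanSpace.single j 1)) s := by
        have h1' := h1
        rw [← sub_self s] at h1'
        exact h1'.comp_sub_const s s
      have h3 : (fun r : ℝ => F (x + s • EuclideanSpace.single j 1
          + (r - s) • EuclideanSpace.single j 1))
          = fun r : ℝ => F (x + r • EuclideanSpace.single j 1) := by
        funext r; congr 1; rw [sub_smul]; abel
      rw [h3] at h2
      exact h2.deriv
    rw [iteratedDeriv_succ, iteratedDeriv_one]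
    have e1 : deriv (fun s : ℝ => u t (x + s • EuclideanSpace.single j 1))
        = fun s : ℝ => spaceDeriv u t j (x + s • EuclideanSpace.single j 1) :=
      funext fun s => key (u t) (spaceDeriv u t j) (hud t j) s
    rw [e1, key (spaceDeriv u t j) (fun y => DD (e j) (e j) (t, y)) (hgd t j j) 0]
    simp
  have z0 : ∀ t ∈ Set.Icc a b, ∀ x : Ed d, R < ‖x‖ → u t x = 0 :=
    fun t ht x hx => h0 t ht x hx.le
  have zg : ∀ t ∈ Set.Icc a b, ∀ j, ∀ x : Ed d, R < ‖x‖ → spaceDeriv u t j x = 0 :=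
    fun t ht j => zero_of_hasLineDerivAt (z0 t ht) (hud t j)
  have zt : ∀ t ∈ Set.Icc a b, ∀ x : Ed d, R < ‖x‖ → D e0 (t, x) = 0 := by
    intro t ht x hx
    have hcl : IsClosed {t | D e0 (t, x) = 0} :=
      isClosed_eq ((cD e0).continuous.comp (by fun_prop)) continuous_const
    have hsub : Set.Ioo a b ⊆ {t | D e0 (t, x) = 0} := by
      intro s hs
      have h1 : (fun s => U (s, x)) =ᶠ[nhds s] fun _ => (0 : ℝ) := by
        filter_upwards [isOpen_Ioo.mem_nhds hs] with r hr
        exact z0 r (Set.Ioo_subset_Icc_self hr) x hx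
      exact (hasDerivAt_time_slice dU s x).unique ((hasDerivAt_const s (0 : ℝ)).congr_of_eventuallyEq h1)
    have := hcl.closure_subset_iff.2 hsub
    rw [closure_Ioo hab.ne] at this
    exact this ht
  have cslice : ∀ (F : ℝ × Ed d → ℝ) (t : ℝ), Continuous F → Continuous fun x => F (t, x) :=
    fun F t hF => hF.comp (by fun_prop)
  have cu : ∀ t, Continuous (u t) := fun t => cslice U t hU.continuous
  have cg : ∀ t j, Continuous (spaceDeriv u t j) := fun t j => cslice _ t (cD (e j)).continuous
  have cw : ∀ t, Continuous fun x => D e0 (t, x) := fun t => cslice _ t (cD e0).continuous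
  have cX : ∀ t, Continuous (morMul ε (u t) (spaceDeriv u t)) := by
    intro t
    have := cu t
    have := cg t
    unfold morMul; fun_prop
  have zX : ∀ t ∈ Set.Icc a b, ∀ x : Ed d, R < ‖x‖ → morMul ε (u t) (spaceDeriv u t) x = 0 := by
    intro t ht x hx
    simp [morMul, z0 t ht x hx, zg t ht _ x hx]
  have cU : Continuous fun p : ℝ × Ed d => u p.1 p.2 := hU.continuous
  have cG : ∀ j, Continuous fun p : ℝ × Ed d => spaceDeriv u p.1 j p.2 :=
    fun j => (cD (e j)).continuous
  have cTform : Continuous fun p : ℝ × Ed d => morForm ε (u p.1) (spaceDeriv u p.1) p.2 := by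
    unfold morForm; fun_prop
  have zT : ∀ t ∈ Set.Icc a b, ∀ x : Ed d, R < ‖x‖ → morForm ε (u t) (spaceDeriv u t) x = 0 := by
    intro t ht x hx
    simp [morForm, z0 t ht x hx, zg t ht _ x hx]
  let h : ℝ × Ed d → ℝ := fun p => D e0 p * morMul ε (u p.1) (spaceDeriv u p.1) p.2
  let W : ℝ → Ed d → ℝ := fun t x => D e0 (t, x)
  let gW : ℝ → Fin d → Ed d → ℝ := fun t j x => DD e0 (e j) (t, x)
  let k : ℝ × Ed d → ℝ := fun p => DD e0 e0 p * morMul ε (u p.1) (spaceDeriv u p.1) p.2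
    + D e0 p * morMul ε (W p.1) (gW p.1) p.2
  have ck' : Continuous k := by
    have := cDD e0 e0
    have := (cD e0).continuous
    have cW : Continuous fun p : ℝ × Ed d => W p.1 p.2 := this
    have cgW : ∀ j, Continuous fun p : ℝ × Ed d => gW p.1 j p.2 := fun j => cDD e0 (e j)
    simp only [k, morMul]
    fun_prop
  have zk : ∀ t ∈ Set.Icc a b, ∀ x, R < ‖x‖ → k (t, x) = 0 := by
    intro t ht x hx
    simp [k, zX t ht x hx, zt t ht x hx]
  have hderiv : ∀ t x, HasDerivAt (fun s => h (s, x)) (k (t, x)) t := by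
    intro t x
    have d1 := hasDerivAt_time_slice (dD e0) t x
    have d2 := hasDerivAt_time_slice dU t x
    have d3 : ∀ j, HasDerivAt (fun s => D (e j) (s, x)) (DD e0 (e j) (t, x)) t := fun j => by
      rw [hsymm]; exact hasDerivAt_time_slice (dD (e j)) t x
    have d4 : HasDerivAt (fun s => ∑ j, x j * D (e j) (s, x))
        (∑ j, x j * DD e0 (e j) (t, x)) t :=
      HasDerivAt.fun_sum (u := Finset.univ) fun j _ => (d3 j).const_mul (x j)
    exact d1.mul ((d4.const_mul (regInv ε x)).add (d2.const_mul (1 / 2 * lapReg ε x)))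
  -- spatial integral of the time derivative
  have hspace : ∀ t ∈ Set.Icc a b,
      ∫ x, k (t, x) ≤ - ∫ x, morForm ε (u t) (spaceDeriv u t) x := by
    intro t ht
    have i1 : Integrable fun x => DD e0 e0 (t, x) * morMul ε (u t) (spaceDeriv u t) x := by
      refine integrable_of_zero (R := R) ((cslice _ t (cDD e0 e0)).mul (cX t)) fun x hx => ?_
      simp [zX t ht x hx]
    have cgW : ∀ j, Continuous (gW t j) := fun j => cslice _ t (cDD e0 (e j))
    have i2 : Integrable fun x => D e0 (t, x) * morMul ε (W t) (gW t) x := by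
      refine integrable_of_zero (R := R) ?_ fun x hx => ?_
      · have := cw t
        have cW : Continuous (W t) := this
        unfold morMul
        fun_prop
      · simp [zt t ht x hx]
    have e1 : ∫ x, D e0 (t, x) * morMul ε (W t) (gW t) x = 0 :=
      integral_mul_morMul_self hε (cw t) cgW (hwd t) (zt t ht)
    have hVu : ∀ x, hartreePot (u t) x * u t x
        = (∑ j, DD (e j) (e j) (t, x)) - DD e0 e0 (t, x) := by
      intro x
      have := hpde t ht x
      rw [htt, hlap] at this
      linarith
    have cVu : Continuous fun x => hartreePot (u t) x * u t x := by
      simp only [hVu]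
      exact (continuous_finsetSum _ fun j _ => cslice _ t (cDD (e j) (e j))).sub
        (cslice _ t (cDD e0 e0))
    have hpos := hartree_morMul_nonneg hd hε (cu t) (cg t) (hud t) (z0 t ht) cVu
    have hid := integral_laplacian_mul_morMul hε (cu t) (cg t)
      (fun i j => cslice _ t (cDD (e i) (e j))) (hud t) (hgd t)
      (fun i j x => hsymm (e i) (e j) (t, x)) (z0 t ht)
    have cT : Continuous (morForm ε (u t) (spaceDeriv u t)) := cslice _ t cTform
    have iT : Integrable (morForm ε (u t) (spaceDeriv u t)) := integrable_of_zero cT (zT t ht)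
    have iV : Integrable fun x => hartreePot (u t) x * u t x * morMul ε (u t) (spaceDeriv u t) x :=
      integrable_of_zero (R := R) (cVu.mul (cX t)) fun x hx => by simp [zX t ht x hx]
    have e2 : ∫ x, k (t, x) = ∫ x, DD e0 e0 (t, x) * morMul ε (u t) (spaceDeriv u t) x := by
      have : ∫ x, k (t, x) = _ := integral_add i1 i2
      rw [this, e1, add_zero]
    have e3 : ∫ x, DD e0 e0 (t, x) * morMul ε (u t) (spaceDeriv u t) x
        = ∫ x, ((((∑ j, DD (e j) (e j) (t, x)) * morMul ε (u t) (spaceDeriv u t) x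
          + morForm ε (u t) (spaceDeriv u t) x)) - morForm ε (u t) (spaceDeriv u t) x
          - hartreePot (u t) x * u t x * morMul ε (u t) (spaceDeriv u t) x) := by
      refine integral_congr_ae (Filter.Eventually.of_forall fun x => ?_)
      simp only [hVu]
      ring
    rw [integral_sub _ iV, integral_sub _ iT, hid] at e3
    · rw [e2, e3]; linarith
    · refine integrable_of_zero (R := R) (Continuous.add (Continuous.mul
        (continuous_finsetSum _ fun j _ => cslice _ t (cDD (e j) (e j))) (cX t)) cT) fun x hx => ?_
      simp [zX t ht x hx, zT t ht x hx]
    · refine integrable_of_zero (R := R) (Continuous.sub (Continuous.add (Continuous.mul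
        (continuous_finsetSum _ fun j _ => cslice _ t (cDD (e j) (e j))) (cX t)) cT) cT)
        fun x hx => ?_
      simp [zX t ht x hx, zT t ht x hx]
  -- energy bound
  have ih : ∀ t ∈ Set.Icc a b, Integrable fun x => h (t, x) := by
    intro t ht
    refine integrable_of_zero (R := R) ((cw t).mul (cX t)) fun x hx => ?_
    simp [h, zX t ht x hx]
  have hP : ∀ t ∈ Set.Icc a b, |∫ x, h (t, x)| ≤ 1 / 2 * M.toReal := by
    intro t ht
    have i1 : Integrable fun x => D e0 (t, x) ^ 2 :=
      integrable_of_zero (R := R) ((cw t).pow 2) fun x hx => by simp [zt t ht x hx]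
    have i2 : Integrable fun x => morMul ε (u t) (spaceDeriv u t) x ^ 2 :=
      integrable_of_zero (R := R) ((cX t).pow 2) fun x hx => by simp [zX t ht x hx]
    have i3 : Integrable fun x => ∑ j, spaceDeriv u t j x ^ 2 :=
      integrable_of_zero (R := R) (continuous_finsetSum _ fun j _ => (cg t j).pow 2)
        fun x hx => by simp [zg t ht _ x hx]
    have h1 : |∫ x, h (t, x)| ≤ ∫ x, 1 / 2 * (D e0 (t, x) ^ 2
        + morMul ε (u t) (spaceDeriv u t) x ^ 2) := by
      refine (abs_integral_le_integral_abs).trans (integral_mono (ih t ht).abs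
        ((i1.add i2).const_mul _) fun x => ?_)
      simp only [h, abs_mul]
      nlinarith [sq_nonneg (|D e0 (t, x)| - |morMul ε (u t) (spaceDeriv u t) x|),
        sq_abs (D e0 (t, x)), sq_abs (morMul ε (u t) (spaceDeriv u t) x)]
    rw [integral_const_mul, integral_add i1 i2] at h1
    have h2 := integral_morMul_sq_le hd hε (cu t) (cg t) (hud t) (z0 t ht)
    have i31 : Integrable fun x => (∑ j, spaceDeriv u t j x ^ 2) + D e0 (t, x) ^ 2 := i3.add i1
    have h3 : ∫ x, ((∑ j, spaceDeriv u t j x ^ 2) + D e0 (t, x) ^ 2) ≤ M.toReal := by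
      rw [integral_eq_lintegral_of_nonneg_ae
        (Filter.Eventually.of_forall fun x => by simp only [Pi.zero_apply]; positivity)
        i31.aestronglyMeasurable]
      refine ENNReal.toReal_mono hM.ne ?_
      simpa only [hgrad, htd] using hE t ht
    rw [integral_add i3 i1] at h3
    linarith
  -- Fubini
  have ik := integrable_slab_of_zero ck' zk
  have iT := integrable_slab_of_zero cTform zT
  have hb : b ∈ Set.Icc a b := ⟨hab.le, le_rfl⟩
  have ha : a ∈ Set.Icc a b := ⟨le_rfl, hab.le⟩
  have f1 : ∫ p, k p ∂((volume.restrict (Set.Icc a b)).prod volume)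
      = (∫ x, h (b, x)) - ∫ x, h (a, x) := by
    rw [integral_prod_symm _ ik, ← integral_sub (ih b hb) (ih a ha)]
    refine integral_congr_ae (Filter.Eventually.of_forall fun x => ?_)
    simp only
    rw [integral_Icc_eq_integral_Ioc, ← intervalIntegral.integral_of_le hab.le]
    exact intervalIntegral.integral_eq_sub_of_hasDerivAt (fun t _ => hderiv t x)
      ((ck'.comp (by fun_prop : Continuous fun t : ℝ => (t, x))).intervalIntegrable _ _)
  have f2 : ∫ p, k p ∂((volume.restrict (Set.Icc a b)).prod volume)
      ≤ - ∫ p : ℝ × Ed d, morForm ε (u p.1) (spaceDeriv u p.1) p.2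
        ∂((volume.restrict (Set.Icc a b)).prod volume) := by
    rw [integral_prod _ ik, integral_prod _ iT, ← integral_neg]
    exact setIntegral_mono_on ik.integral_prod_left iT.integral_prod_left.neg measurableSet_Icc
      fun t ht => hspace t ht
  rw [← ofReal_integral_eq_lintegral_ofReal iT
    (Filter.Eventually.of_forall fun p => morForm_nonneg hd hε _ _ _)]
  refine ENNReal.ofReal_le_of_le_toReal ?_
  have p1 := abs_le.1 (hP b hb)
  have p2 := abs_le.1 (hP a ha)
  linarith

/-- Sobolev inequality `‖u‖_{2 m / (m - 2)} ≤ C ‖∇u‖_2` in `ℝ^m`, in squared form. -/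
lemma exists_sobolev_const {m : ℕ} (hm : 3 ≤ m) : ∃ C : ℝ≥0∞, C ≠ ⊤ ∧
    ∀ u : Ed m → ℝ, ContDiff ℝ 1 u → HasCompactSupport u →
      (∫⁻ x, ‖u x‖ₑ ^ (2 * m / (m - 2) : ℝ)) ^ ((m - 2) / m : ℝ)
        ≤ C * ∫⁻ x, ‖fderiv ℝ u x‖ₑ ^ (2 : ℝ) := by
  have hm' : (3 : ℝ) ≤ m := by exact_mod_cast hm
  let p' : NNReal := ⟨2 * m / (m - 2), div_nonneg (by positivity) (by linarith)⟩
  have hp'v : (p' : ℝ) = 2 * m / (m - 2) := rfl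
  have hp'pos : (0 : ℝ) < 2 * m / (m - 2) := div_pos (by linarith) (by linarith)
  let c : NNReal := eLpNormLESNormFDerivOfEqInnerConst (volume : Measure (Ed m)) 2
  refine ⟨(c : ℝ≥0∞) ^ (2 : ℝ), ENNReal.rpow_ne_top_of_nonneg (by norm_num) ENNReal.coe_ne_top,
    fun u hu hc => ?_⟩
  have h := eLpNorm_le_eLpNorm_fderiv_of_eq_inner (volume : Measure (Ed m)) hu hc
    (p := 2) (p' := p') (by norm_num) (by simp; omega) (by
      rw [hp'v]
      simp only [finrank_euclideanSpace, Fintype.card_fin]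
      push_cast
      have : (m : ℝ) - 2 ≠ 0 := by linarith
      field_simp)
  rw [eLpNorm_eq_lintegral_rpow_enorm_toReal (by
      intro h0; rw [ENNReal.coe_eq_zero] at h0
      rw [← hp'v, h0] at hp'pos; simp at hp'pos) (by simp),
    eLpNorm_eq_lintegral_rpow_enorm_toReal (by simp) (by simp)] at h
  simp only [ENNReal.coe_toReal, hp'v, NNReal.coe_ofNat] at h
  have h2 := ENNReal.rpow_le_rpow h (z := 2) (by norm_num)
  rw [ENNReal.mul_rpow_of_nonneg _ _ (by norm_num), ← ENNReal.rpow_mul, ← ENNReal.rpow_mul] at h2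
  have e1 : 1 / (2 * m / (m - 2) : ℝ) * 2 = (m - 2) / m := by
    have : (m : ℝ) - 2 ≠ 0 := by linarith
    field_simp
  rw [e1] at h2
  simpa [c] using h2

lemma norm_gradient_eq {m : ℕ} (f : Ed m → ℝ) (x : Ed m) : ‖gradient f x‖ = ‖fderiv ℝ f x‖ := by
  rw [gradient, LinearIsometryEquiv.norm_map]

lemma lintegral_eq_mul_lintegral_comp_smul {E : Type*} [NormedAddCommGroup E] [NormedSpace ℝ E]
    [MeasurableSpace E] [BorelSpace E] [FiniteDimensional ℝ E] (μ : Measure E)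
    [μ.IsAddHaarMeasure] {c : ℝ} (hc : 0 < c) {F : E → ℝ≥0∞} (hF : Measurable F) :
    ∫⁻ x, F x ∂μ = ENNReal.ofReal (c ^ Module.finrank ℝ E) * ∫⁻ x, F (c • x) ∂μ := by
  have h := lintegral_map (μ := μ) hF (measurable_const_smul c)
  rw [Measure.map_addHaar_smul μ hc.ne', lintegral_smul_measure] at h
  have hpos : 0 < c ^ Module.finrank ℝ E := pow_pos hc _
  rw [← h, smul_eq_mul, ← mul_assoc, ← ENNReal.ofReal_mul hpos.le, abs_of_pos (inv_pos.2 hpos),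
    mul_inv_cancel₀ hpos.ne', ENNReal.ofReal_one, one_mul]

lemma setLIntegral_Ioi_eq_mul_comp_mul {c : ℝ} (hc : 0 < c) {F : ℝ → ℝ≥0∞} (hF : Measurable F) :
    ∫⁻ s in Set.Ioi 0, F s = ∫⁻ r in Set.Ioi (0 : ℝ), ENNReal.ofReal c * F (c * r) := by
  rw [lintegral_const_mul _ (by fun_prop), ← lintegral_indicator measurableSet_Ioi,
    ← lintegral_indicator measurableSet_Ioi,
    lintegral_eq_mul_lintegral_comp_smul volume hc (hF.indicator measurableSet_Ioi)]
  simp only [Module.finrank_self, pow_one, smul_eq_mul]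
  congr 2
  funext r
  simp [Set.indicator_apply, hc]

/-- `L` is an isometric, measure preserving identification of `ℝ × ℝⁿ` with `ℝⁿ⁺¹`. -/
structure IsSplitting {n : ℕ} (L : ℝ × Ed n →L[ℝ] Ed (n + 1)) : Prop where
  norm_sq : ∀ s z, ‖L (s, z)‖ ^ 2 = s ^ 2 + ‖z‖ ^ 2
  measurePreserving : MeasurePreserving L

lemma IsSplitting.injective {n : ℕ} {L : ℝ × Ed n →L[ℝ] Ed (n + 1)} (hL : IsSplitting L) :
    Function.Injective L := by
  rw [injective_iff_map_eq_zero]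
  rintro ⟨s, z⟩ h
  have := hL.norm_sq s z
  rw [h, norm_zero] at this
  have hs : s ^ 2 = 0 := by nlinarith [sq_nonneg s, sq_nonneg ‖z‖]
  have hz : ‖z‖ ^ 2 = 0 := by nlinarith [sq_nonneg s, sq_nonneg ‖z‖]
  simp only [Prod.mk_eq_zero]
  exact ⟨by simpa using hs, by simpa using hz⟩

/-- Polar coordinates in which directions are parametrised by the hyperplane `L (1, ·)`. -/
def polar {n : ℕ} (L : ℝ × Ed n →L[ℝ] Ed (n + 1)) (r : ℝ) (z : Ed n) : Ed (n + 1) :=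
  (r * regInv 1 z) • L (1, z)

lemma continuous_polar {n : ℕ} (L : ℝ × Ed n →L[ℝ] Ed (n + 1)) :
    Continuous fun p : ℝ × Ed n => polar L p.1 p.2 := by
  have := continuous_regInv (d := n) one_pos
  unfold polar
  fun_prop

lemma lintegral_polar {n : ℕ} {L : ℝ × Ed n →L[ℝ] Ed (n + 1)} (hL : IsSplitting L)
    {F : Ed (n + 1) → ℝ≥0∞} (hF : Measurable F) :
    ∫⁻ z : Ed n, ∫⁻ r in Set.Ioi (0 : ℝ),
        ENNReal.ofReal (regInv 1 z ^ (n + 1) * r ^ n) * F (polar L r z)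
      = ∫⁻ x in L '' (Set.Ioi 0 ×ˢ Set.univ), F x := by
  have hemb : MeasurableEmbedding L := L.continuous.measurableEmbedding hL.injective
  rw [← hL.measurePreserving.setLIntegral_comp_emb hemb, Measure.volume_eq_prod,
    ← Measure.prod_restrict, Measure.restrict_univ,
    lintegral_prod _ (by have := L.continuous.measurable; fun_prop)]
  have hstep : ∀ s ∈ Set.Ioi (0 : ℝ), ∫⁻ z, F (L (s, z))
      = ∫⁻ z, ENNReal.ofReal (s ^ n) * F (s • L (1, z)) := by
    intro s hs
    rw [lintegral_eq_mul_lintegral_comp_smul volume hs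
      (by have := L.continuous.measurable; fun_prop), lintegral_const_mul _
      (by have := L.continuous.measurable; fun_prop)]
    simp [← map_smul]
  rw [setLIntegral_congr_fun measurableSet_Ioi hstep]
  refine Eq.trans ?_ (lintegral_lintegral_swap ?_).symm
  · refine lintegral_congr fun z => ?_
    have hw := regInv_pos one_pos z
    symm
    rw [setLIntegral_Ioi_eq_mul_comp_mul hw (by fun_prop)]
    refine setLIntegral_congr_fun measurableSet_Ioi fun r hr => ?_
    rw [← mul_assoc, ← ENNReal.ofReal_mul hw.le, polar, mul_comm r]
    congr 2
    ring
  · have := L.continuous.measurable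
    refine Measurable.aemeasurable ?_
    unfold Function.uncurry
    fun_prop

/-- Insert `c * s` as the `i`-th coordinate. -/
def insertCoord {n : ℕ} (i : Fin (n + 1)) (c : ℝ) : ℝ × Ed n →L[ℝ] Ed (n + 1) :=
  LinearMap.toContinuousLinearMap
    { toFun := fun p => WithLp.toLp 2 (i.insertNth (c * p.1) p.2.ofLp : Fin (n + 1) → ℝ)
      map_add' := fun p q => by
        ext j
        refine Fin.succAboveCases i ?_ (fun k => ?_) j <;> simp [mul_add]
      map_smul' := fun r p => by
        ext j
        refine Fin.succAboveCases i ?_ (fun k => ?_) j <;> simp [mul_left_comm] }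

lemma insertCoord_apply {n : ℕ} (i : Fin (n + 1)) (c : ℝ) (p : ℝ × Ed n) :
    insertCoord i c p = WithLp.toLp 2 (i.insertNth (c * p.1) p.2.ofLp : Fin (n + 1) → ℝ) := rfl

lemma isSplitting_insertCoord {n : ℕ} (i : Fin (n + 1)) {c : ℝ} (hc : |c| = 1) :
    IsSplitting (insertCoord i c) := by
  have hc2 : c ^ 2 = 1 := by rw [← sq_abs, hc, one_pow]
  refine ⟨fun s z => ?_, ?_⟩
  · rw [EuclideanSpace.norm_sq_eq, EuclideanSpace.norm_sq_eq, Fin.sum_univ_succAbove _ i]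
    simp [insertCoord_apply, mul_pow, hc2]
  · have h1 : MeasurePreserving (fun s : ℝ => c * s) := by
      refine ⟨by fun_prop, ?_⟩
      have hc0 : c ≠ 0 := by rintro rfl; simp at hc
      have := Real.map_volume_mul_left hc0
      rw [this, abs_inv, hc]
      simp
    have h2 := h1.prod (PiLp.volume_preserving_ofLp (Fin n))
    have h3 := (volume_preserving_piFinSuccAbove (fun _ : Fin (n + 1) => ℝ) i).symm
    exact (PiLp.volume_preserving_toLp (Fin (n + 1))).comp (h3.comp h2)

/-- The cone around the first coordinate axis. -/
def axisCone (n : ℕ) : Set (ℝ × Ed n) := {p | 0 < p.1 ∧ ‖p.2‖ ^ 2 ≤ n * p.1 ^ 2}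

lemma exists_mem_insertCoord_image {n : ℕ} {x : Ed (n + 1)} (hx : x ≠ 0) :
    ∃ q : Fin (n + 1) × Bool,
      x ∈ insertCoord q.1 (if q.2 then 1 else -1) '' axisCone n := by
  obtain ⟨i, hi⟩ := Finite.exists_max fun i => |x i|
  have hi0 : 0 < |x i| := by
    by_contra hle
    refine hx ?_
    ext j
    have := hi j
    simpa using abs_nonpos_iff.1 (this.trans (not_lt.1 hle))
  have hcone : (|x i|, (WithLp.toLp 2 (i.removeNth x.ofLp) : Ed n)) ∈ axisCone n := by
    refine ⟨hi0, ?_⟩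
    rw [EuclideanSpace.norm_sq_eq]
    refine (Finset.sum_le_card_nsmul _ _ (|x i| ^ 2) fun j _ => ?_).trans ?_
    · exact pow_le_pow_left₀ (norm_nonneg _) (hi _) 2
    · simp
  refine ⟨(i, decide (0 ≤ x i)), _, hcone, ?_⟩
  ext j
  refine Fin.succAboveCases i ?_ (fun k => ?_) j
  · by_cases h : 0 ≤ x i
    · simp [insertCoord_apply, h, abs_of_nonneg]
    · simp [insertCoord_apply, h, abs_of_neg (not_le.1 h)]
  · simp [insertCoord_apply]

lemma lintegral_le_of_forall_isSplitting {n : ℕ} {F : Ed (n + 1) → ℝ≥0∞} {A : ℝ≥0∞}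
    (h : ∀ L : ℝ × Ed n →L[ℝ] Ed (n + 1), IsSplitting L → ∫⁻ x in L '' axisCone n, F x ≤ A) :
    ∫⁻ x, F x ≤ (Fintype.card (Fin (n + 1) × Bool) : ℝ≥0∞) * A := by
  let S : Fin (n + 1) × Bool → Set (Ed (n + 1)) := fun q =>
    insertCoord q.1 (if q.2 then 1 else -1) '' axisCone n
  have hae : (⋃ q, S q) =ᵐ[volume] Set.univ := by
    refine Filter.eventuallyEq_univ.2 (mem_ae_iff.2 ?_)
    refine measure_mono_null (fun x hx => ?_) (measure_singleton (0 : Ed (n + 1)))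
    by_contra hne
    exact hx (Set.mem_iUnion.2 (exists_mem_insertCoord_image hne))
  rw [← setLIntegral_univ, ← setLIntegral_congr hae]
  refine (lintegral_iUnion_le _ _).trans ?_
  rw [tsum_fintype]
  refine (Finset.sum_le_card_nsmul _ _ A fun q _ =>
    h _ (isSplitting_insertCoord _ ?_)).trans_eq (by simp [Finset.card_univ])
  split_ifs <;> simp

lemma polar_eq {n : ℕ} (L : ℝ × Ed n →L[ℝ] Ed (n + 1)) (r : ℝ) (z : Ed n) :
    polar L r z = L (r * regInv 1 z, (r * regInv 1 z) • z) := by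
  rw [polar, ← map_smul]
  simp

lemma setLIntegral_axisCone_le {n : ℕ} {L : ℝ × Ed n →L[ℝ] Ed (n + 1)} (hL : IsSplitting L)
    {F : Ed (n + 1) → ℝ≥0∞} (hF : Measurable F) :
    ∫⁻ x in L '' axisCone n, F x ≤ ∫⁻ r in Set.Ioi (0 : ℝ), ENNReal.ofReal (r ^ n) *
      ∫⁻ z in Metric.closedBall 0 √n, F (polar L r z) := by
  have hemb : MeasurableEmbedding L := L.continuous.measurableEmbedding hL.injective
  have hcone : MeasurableSet (axisCone n) := by
    have h1 : Measurable fun p : ℝ × Ed n => ‖p.2‖ ^ 2 := by fun_prop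
    have h2 : Measurable fun p : ℝ × Ed n => (n : ℝ) * p.1 ^ 2 := by fun_prop
    exact (measurableSet_lt measurable_const measurable_fst).inter (measurableSet_le h1 h2)
  have hm := hemb.measurableSet_image.2 hcone
  have hsub : L '' axisCone n ⊆ L '' (Set.Ioi 0 ×ˢ Set.univ) :=
    Set.image_mono fun p hp => ⟨hp.1, trivial⟩
  have hp := (continuous_polar L).measurable
  have hw : Measurable (regInv (d := n) 1) := (continuous_regInv one_pos).measurable
  calc ∫⁻ x in L '' axisCone n, F x
      = ∫⁻ x in L '' (Set.Ioi 0 ×ˢ Set.univ), (L '' axisCone n).indicator F x := by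
        rw [setLIntegral_indicator hm, Set.inter_eq_left.2 hsub]
    _ = ∫⁻ z : Ed n, ∫⁻ r in Set.Ioi (0 : ℝ), ENNReal.ofReal (regInv 1 z ^ (n + 1) * r ^ n) *
          (L '' axisCone n).indicator F (polar L r z) :=
        (lintegral_polar hL (hF.indicator hm)).symm
    _ ≤ ∫⁻ z : Ed n, ∫⁻ r in Set.Ioi (0 : ℝ), ENNReal.ofReal (r ^ n) *
          (Metric.closedBall (0 : Ed n) √n).indicator (fun z => F (polar L r z)) z := by
        refine lintegral_mono fun z => setLIntegral_mono' measurableSet_Ioi fun r hr => ?_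
        have hr : 0 < r := hr
        have hwp := regInv_pos one_pos z
        have hw1 : regInv 1 z ≤ 1 := by
          have := regInv_sq one_pos z
          by_contra hgt
          nlinarith [sq_nonneg ‖z‖, mul_nonneg (sq_nonneg (regInv 1 z)) (sq_nonneg ‖z‖)]
        refine mul_le_mul' (ENNReal.ofReal_le_ofReal
          (mul_le_of_le_one_left (by positivity) (pow_le_one₀ hwp.le hw1))) ?_
        refine Set.indicator_apply_le' (fun hx => ?_) fun _ => zero_le
        rw [polar_eq, hL.injective.mem_set_image] at hx
        rw [Set.indicator_of_mem]
        obtain ⟨-, h2⟩ := hx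
        rw [norm_smul, mul_pow, Real.norm_eq_abs, sq_abs, mul_comm (n : ℝ)] at h2
        have h3 := le_of_mul_le_mul_left h2 (by positivity)
        rw [mem_closedBall_zero_iff]
        exact Real.le_sqrt_of_sq_le h3
    _ = ∫⁻ r in Set.Ioi (0 : ℝ), ∫⁻ z : Ed n, ENNReal.ofReal (r ^ n) *
          (Metric.closedBall (0 : Ed n) √n).indicator (fun z => F (polar L r z)) z := by
        refine lintegral_lintegral_swap (Measurable.aemeasurable ?_)
        have : Measurable fun p : Ed n × ℝ =>
            (Prod.fst ⁻¹' Metric.closedBall (0 : Ed n) √n).indicator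
              (fun p : Ed n × ℝ => F (polar L p.2 p.1)) p :=
          (hF.comp (hp.comp measurable_swap)).indicator (measurable_fst measurableSet_closedBall)
        exact (by fun_prop : Measurable fun p : Ed n × ℝ => ENNReal.ofReal (p.2 ^ n)).mul this
    _ = _ := by
        refine lintegral_congr fun r => ?_
        have hpr : Measurable fun z => F (polar L r z) :=
          hF.comp (hp.comp (by fun_prop : Measurable fun z => (r, z)))
        rw [lintegral_const_mul _ (hpr.indicator measurableSet_closedBall),
          lintegral_indicator measurableSet_closedBall]

lemma lintegral_closedBall_polar_le {n : ℕ} {L : ℝ × Ed n →L[ℝ] Ed (n + 1)}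
    (hL : IsSplitting L) {F : Ed (n + 1) → ℝ≥0∞} (hF : Measurable F) (K : ℝ) :
    ∫⁻ r in Set.Ioi (0 : ℝ), ENNReal.ofReal (r ^ n) *
      ∫⁻ z in Metric.closedBall 0 K, F (polar L r z)
      ≤ ENNReal.ofReal (√(1 + K ^ 2) ^ (n + 1)) * ∫⁻ x, F x := by
  have hp := (continuous_polar L).measurable
  calc ∫⁻ r in Set.Ioi (0 : ℝ), ENNReal.ofReal (r ^ n) *
        ∫⁻ z in Metric.closedBall 0 K, F (polar L r z)
      = ∫⁻ r in Set.Ioi (0 : ℝ), ∫⁻ z in Metric.closedBall 0 K,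
          ENNReal.ofReal (r ^ n) * F (polar L r z) :=
        lintegral_congr fun r => (lintegral_const_mul' _ _ ENNReal.ofReal_ne_top).symm
    _ = ∫⁻ z in Metric.closedBall 0 K, ∫⁻ r in Set.Ioi (0 : ℝ),
          ENNReal.ofReal (r ^ n) * F (polar L r z) := by
        refine lintegral_lintegral_swap (Measurable.aemeasurable ?_)
        exact (by fun_prop : Measurable fun p : ℝ × Ed n => ENNReal.ofReal (p.1 ^ n)).mul
          (hF.comp hp)
    _ ≤ ∫⁻ z in Metric.closedBall 0 K, ∫⁻ r in Set.Ioi (0 : ℝ),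
          ENNReal.ofReal (√(1 + K ^ 2) ^ (n + 1)) *
            (ENNReal.ofReal (regInv 1 z ^ (n + 1) * r ^ n) * F (polar L r z)) := by
        refine setLIntegral_mono' measurableSet_closedBall fun z hz =>
          setLIntegral_mono' measurableSet_Ioi fun r hr => ?_
        have hr : 0 < r := hr
        rw [← mul_assoc, ← ENNReal.ofReal_mul (by positivity)]
        refine mul_le_mul' (ENNReal.ofReal_le_ofReal ?_) le_rfl
        rw [← mul_assoc, ← mul_pow]
        refine le_mul_of_one_le_left (by positivity) (one_le_pow₀ ?_)
        rw [regInv, ← div_eq_mul_inv, one_le_div (by positivity)]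
        rw [mem_closedBall_zero_iff] at hz
        refine Real.sqrt_le_sqrt ?_
        rw [one_pow]
        gcongr
    _ ≤ ∫⁻ z, ∫⁻ r in Set.Ioi (0 : ℝ), ENNReal.ofReal (√(1 + K ^ 2) ^ (n + 1)) *
            (ENNReal.ofReal (regInv 1 z ^ (n + 1) * r ^ n) * F (polar L r z)) :=
        setLIntegral_le_lintegral _ _
    _ = ENNReal.ofReal (√(1 + K ^ 2) ^ (n + 1)) * ∫⁻ x in L '' (Set.Ioi 0 ×ˢ Set.univ), F x := by
        rw [← lintegral_polar hL hF, ← lintegral_const_mul' _ _ ENNReal.ofReal_ne_top]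
        exact lintegral_congr fun z => lintegral_const_mul' _ _ ENNReal.ofReal_ne_top
    _ ≤ _ := mul_le_mul' le_rfl (setLIntegral_le_lintegral _ _)

lemma IsSplitting.inner_eq {n : ℕ} {L : ℝ × Ed n →L[ℝ] Ed (n + 1)} (hL : IsSplitting L)
    (s s' : ℝ) (z z' : Ed n) : ⟪L (s, z), L (s', z')⟫ = s * s' + ⟪z, z'⟫ := by
  have h1 := norm_add_sq_real (L (s, z)) (L (s', z'))
  rw [← map_add, Prod.mk_add_mk, hL.norm_sq, hL.norm_sq, hL.norm_sq, norm_add_sq_real] at h1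
  linarith

lemma contDiff_regInv {n : ℕ} : ContDiff ℝ 1 (regInv (d := n) 1) := by
  unfold regInv
  have h : ∀ x : Ed n, (1 : ℝ) ^ 2 + ‖x‖ ^ 2 ≠ 0 := fun x => by positivity
  refine ContDiff.inv (ContDiff.sqrt ?_ h) fun x => by positivity
  exact contDiff_const.add (contDiff_norm_sq ℝ)

lemma hasFDerivAt_regInv {n : ℕ} (z : Ed n) :
    HasFDerivAt (regInv (d := n) 1) (-(regInv 1 z ^ 3) • innerSL ℝ z) z := by
  have h1 : HasFDerivAt (fun x : Ed n => (1 : ℝ) ^ 2 + ‖x‖ ^ 2) (2 • innerSL ℝ z) z :=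
    (hasStrictFDerivAt_norm_sq z).hasFDerivAt.const_add _
  have hpos : 0 < (1 : ℝ) ^ 2 + ‖z‖ ^ 2 := by positivity
  have h2 := h1.sqrt hpos.ne'
  have h3 := (hasDerivAt_inv (Real.sqrt_pos.2 hpos).ne').comp_hasFDerivAt z h2
  have hs := Real.sqrt_pos.2 hpos
  refine HasFDerivAt.congr_fderiv h3 ?_
  refine ContinuousLinearMap.ext fun v => ?_
  simp only [regInv, smul_apply, smul_eq_mul, nsmul_eq_mul]
  field_simp
  push_cast
  ring

lemma norm_polar {n : ℕ} {L : ℝ × Ed n →L[ℝ] Ed (n + 1)} (hL : IsSplitting L) {r : ℝ}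
    (hr : 0 ≤ r) (z : Ed n) : ‖polar L r z‖ = r := by
  have hw := regInv_pos one_pos z
  have h := regInv_sq one_pos z
  refine (sq_eq_sq₀ (norm_nonneg _) hr).1 ?_
  rw [polar, norm_smul, mul_pow, hL.norm_sq, Real.norm_eq_abs, sq_abs]
  linear_combination r ^ 2 * h

lemma contDiff_polar {n : ℕ} (L : ℝ × Ed n →L[ℝ] Ed (n + 1)) :
    ContDiff ℝ 1 fun p : ℝ × Ed n => polar L p.1 p.2 := by
  unfold polar
  exact (contDiff_fst.mul (contDiff_regInv.comp contDiff_snd)).smul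
    (L.contDiff.comp (contDiff_const.prodMk contDiff_snd))

/-- The squared length of the angular part of the gradient. -/
def angularSq {m : ℕ} (f : Ed m → ℝ) (x : Ed m) : ℝ :=
  ‖gradient f x‖ ^ 2 - ⟪x, gradient f x⟫ ^ 2 / ‖x‖ ^ 2

lemma angularSq_nonneg {m : ℕ} (f : Ed m → ℝ) (x : Ed m) : 0 ≤ angularSq f x := by
  have h := abs_real_inner_le_norm x (gradient f x)
  rw [angularSq, sub_nonneg]
  refine div_le_of_le_mul₀ (by positivity) (by positivity) ?_
  rw [← sq_abs, ← mul_pow, mul_comm]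
  exact pow_le_pow_left₀ (abs_nonneg _) h 2

lemma sq_inner_gradient_le {m : ℕ} (f : Ed m → ℝ) {x v : Ed m} (hx : x ≠ 0) (hv : ⟪x, v⟫ = 0) :
    ⟪gradient f x, v⟫ ^ 2 ≤ angularSq f x * ‖v‖ ^ 2 := by
  set g := gradient f x
  have hx' : ‖x‖ ^ 2 ≠ 0 := by simpa using hx
  set c := ⟪x, g⟫ / ‖x‖ ^ 2 with hc
  have h1 : ⟪g - c • x, v⟫ = ⟪g, v⟫ := by rw [inner_sub_left, real_inner_smul_left, hv]; ring
  have h2 : ‖g - c • x‖ ^ 2 = angularSq f x := by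
    rw [norm_sub_sq_real, real_inner_smul_right, norm_smul, mul_pow, Real.norm_eq_abs, sq_abs,
      real_inner_comm, angularSq, hc]
    field_simp
    ring
  rw [← h1, ← h2, ← mul_pow, ← sq_abs]
  exact pow_le_pow_left₀ (abs_nonneg _) (abs_real_inner_le_norm _ _) 2

lemma norm_fderiv_comp_polar_sq_le {n : ℕ} {L : ℝ × Ed n →L[ℝ] Ed (n + 1)}
    (hL : IsSplitting L) {f : Ed (n + 1) → ℝ} (hf : Differentiable ℝ f) {r : ℝ} (hr : 0 < r)
    (z : Ed n) :
    ‖fderiv ℝ (fun z => f (polar L r z)) z‖ ^ 2 ≤ r ^ 2 * angularSq f (polar L r z) := by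
  set w := regInv 1 z with hw_def
  have hw := regInv_pos one_pos z
  have hw2 := regInv_sq one_pos z
  rw [← hw_def] at hw hw2
  set x := polar L r z with hx_def
  have hS := angularSq_nonneg f x
  have hx : x ≠ 0 := by
    rw [← norm_pos_iff, hx_def, norm_polar hL hr.le]; exact hr
  have hd : HasFDerivAt (polar L r) _ z :=
    ((hasFDerivAt_regInv z).const_mul r).smul
      (L.hasFDerivAt.comp z (hasFDerivAt_prodMk_right 1 z))
  have hc := (hf x).hasFDerivAt.comp z hd
  have hfd : fderiv ℝ (fun z => f (polar L r z)) z = _ := hc.fderiv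
  rw [← Real.sqrt_le_sqrt_iff (by positivity), Real.sqrt_sq (norm_nonneg _)]
  refine ContinuousLinearMap.opNorm_le_bound _ (Real.sqrt_nonneg _) fun v => ?_
  rw [Real.norm_eq_abs]
  refine abs_le_of_sq_le_sq ?_ (by positivity)
  rw [mul_pow, Real.sq_sqrt (by positivity), hfd]
  set y := (r * w) • L (0, v) - (r * w ^ 3 * ⟪z, v⟫) • L (1, z) with hy
  have e1 : ∀ v', (fderiv ℝ f x) v' = ⟪gradient f x, v'⟫ := fun v' => by
    rw [gradient, InnerProductSpace.toDual_symm_apply]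
  have e2 : ⟪x, y⟫ = 0 := by
    rw [hx_def, hy, polar, inner_sub_right]
    simp only [real_inner_smul_left, real_inner_smul_right, hL.inner_eq, ← hw_def,
      real_inner_self_eq_norm_sq]
    linear_combination (-(r ^ 2 * w ^ 2 * ⟪z, v⟫)) * hw2
  have e3 : ‖y‖ ^ 2 ≤ r ^ 2 * ‖v‖ ^ 2 := by
    rw [hy, norm_sub_sq_real]
    simp only [real_inner_smul_left, real_inner_smul_right, hL.inner_eq, norm_smul, mul_pow,
      Real.norm_eq_abs, sq_abs, hL.norm_sq, real_inner_comm z v]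
    have h1 : w ^ 2 ≤ 1 := by nlinarith [mul_nonneg (sq_nonneg w) (sq_nonneg ‖z‖)]
    have h2 : 0 ≤ r ^ 2 * (w ^ 4 * ⟪z, v⟫ ^ 2) := by positivity
    have h3 : r ^ 2 * (w ^ 2 * ‖v‖ ^ 2) ≤ r ^ 2 * ‖v‖ ^ 2 := by
      gcongr; exact mul_le_of_le_one_left (by positivity) h1
    have h4 : (r * w ^ 3 * ⟪z, v⟫) ^ 2 * (1 ^ 2 + ‖z‖ ^ 2) = r ^ 2 * (w ^ 4 * ⟪z, v⟫ ^ 2) := by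
      linear_combination (r ^ 2 * w ^ 4 * ⟪z, v⟫ ^ 2) * hw2
    nlinarith
  have e4 := sq_inner_gradient_le f hx e2
  have e5 : ((r * regInv 1 z) • L ∘SL ContinuousLinearMap.inr ℝ ℝ (Ed n) +
      (r • -regInv 1 z ^ 3 • innerSL ℝ z).smulRight (L (1, z))) v = y := by
    simp only [add_apply, smul_apply,
      ContinuousLinearMap.comp_apply, ContinuousLinearMap.inr_apply,
      ContinuousLinearMap.smulRight_apply, innerSL_apply_apply, smul_eq_mul, hy, ← hw_def]
    rw [sub_eq_add_neg, ← neg_smul]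
    ring_nf
  rw [ContinuousLinearMap.comp_apply, e5, e1]
  calc _ ≤ _ := e4
    _ ≤ angularSq f x * (r ^ 2 * ‖v‖ ^ 2) := by gcongr
    _ = _ := by ring

lemma hasDerivAt_comp_polar {n : ℕ} {L : ℝ × Ed n →L[ℝ] Ed (n + 1)} {f : Ed (n + 1) → ℝ}
    (hf : Differentiable ℝ f) (r : ℝ) (z : Ed n) :
    HasDerivAt (fun ρ => f (polar L ρ z)) (fderiv ℝ f (polar L r z) (polar L 1 z)) r := by
  have h1 : HasDerivAt (fun ρ => polar L ρ z) (polar L 1 z) r := by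
    unfold polar
    exact ((hasDerivAt_id r).mul_const (regInv 1 z)).smul_const (L (1, z))
  exact (hf _).hasFDerivAt.comp_hasDerivAt r h1

lemma norm_deriv_comp_polar_le {n : ℕ} {L : ℝ × Ed n →L[ℝ] Ed (n + 1)} (hL : IsSplitting L)
    {f : Ed (n + 1) → ℝ} (hf : Differentiable ℝ f) (r : ℝ) (z : Ed n) :
    ‖deriv (fun ρ => f (polar L ρ z)) r‖ ≤ ‖fderiv ℝ f (polar L r z)‖ := by
  rw [(hasDerivAt_comp_polar hf r z).deriv]
  have := (fderiv ℝ f (polar L r z)).le_opNorm (polar L 1 z)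
  rwa [norm_polar hL zero_le_one, mul_one] at this

lemma exists_lintegral_fderiv_rpow_const {n : ℕ} (hn : 4 ≤ n) : ∃ C : ℝ≥0∞, C ≠ ⊤ ∧
    ∀ f : Ed (n + 1) → ℝ, ContDiff ℝ 1 f → HasCompactSupport f →
      ∫⁻ x, ‖fderiv ℝ (fun x => ‖f x‖ ^ (2 * n / (n - 1) : ℝ)) x‖ₑ
        ≤ C * (∫⁻ x, ‖fderiv ℝ f x‖ₑ ^ (2 : ℝ)) ^ (n / (n - 1) : ℝ) := by
  have hn' : (4 : ℝ) ≤ n := by exact_mod_cast hn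
  obtain ⟨C, hC, hsob⟩ := exists_sobolev_const (m := n + 1) (by omega)
  let q : NNReal := ⟨2 * n / (n - 1), div_nonneg (by positivity) (by linarith)⟩
  have hqv : (q : ℝ) = 2 * n / (n - 1) := rfl
  have hq1 : (1 : ℝ) < 2 * n / (n - 1) := by rw [lt_div_iff₀ (by linarith)]; linarith
  set α : ℝ := (n + 1) / (2 * (n - 1)) with hα
  have hα0 : 0 ≤ α := div_nonneg (by linarith) (by linarith)
  refine ⟨q * C ^ α, ENNReal.mul_ne_top ENNReal.coe_ne_top
    (ENNReal.rpow_ne_top_of_nonneg hα0 hC), fun f hf hc => ?_⟩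
  set E := ∫⁻ x, ‖fderiv ℝ f x‖ₑ ^ (2 : ℝ) with hE
  have cf := hf.continuous
  have cdf := hf.continuous_fderiv one_ne_zero
  have hs := hsob f hf hc
  push_cast at hs
  have hs2 : (∫⁻ x, ‖f x‖ₑ ^ (2 * (n + 1) / (n + 1 - 2) : ℝ)) ^ (1 / 2 : ℝ) ≤ C ^ α * E ^ α := by
    rw [← ENNReal.mul_rpow_of_nonneg _ _ hα0]
    have := ENNReal.rpow_le_rpow hs hα0
    rw [← ENNReal.rpow_mul] at this
    convert this using 2
    rw [hα]
    have h1 : (n : ℝ) - 1 ≠ 0 := by linarith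
    have h2 : (n : ℝ) + 1 - 2 = n - 1 := by ring
    rw [h2]
    field_simp
  calc ∫⁻ x, ‖fderiv ℝ (fun x => ‖f x‖ ^ (2 * n / (n - 1) : ℝ)) x‖ₑ
      ≤ ∫⁻ x, q * (‖f x‖ₑ ^ ((q : ℝ) - 1) * ‖fderiv ℝ f x‖ₑ) := by
        refine lintegral_mono fun x => ?_
        rw [← mul_assoc]
        exact enorm_fderiv_norm_rpow_le (p := q) (hf.differentiable one_ne_zero) hq1
    _ = q * ∫⁻ x, ‖f x‖ₑ ^ ((q : ℝ) - 1) * ‖fderiv ℝ f x‖ₑ :=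
        lintegral_const_mul' _ _ ENNReal.coe_ne_top
    _ ≤ q * ((∫⁻ x, (‖f x‖ₑ ^ ((q : ℝ) - 1)) ^ (2 : ℝ)) ^ (1 / 2 : ℝ) * E ^ (1 / 2 : ℝ)) := by
        gcongr
        exact ENNReal.lintegral_mul_le_Lp_mul_Lq volume Real.HolderConjugate.two_two
          (cf.enorm.measurable.pow_const _).aemeasurable cdf.enorm.measurable.aemeasurable
    _ ≤ q * ((C ^ α * E ^ α) * E ^ (1 / 2 : ℝ)) := by
        gcongr
        refine le_of_eq_of_le (congrArg (· ^ (1 / 2 : ℝ)) (lintegral_congr fun x => ?_)) hs2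
        rw [← ENNReal.rpow_mul, hqv]
        congr 1
        have h1 : (n : ℝ) - 1 ≠ 0 := by linarith
        have h2 : (n : ℝ) + 1 - 2 = n - 1 := by ring
        rw [h2]
        field_simp
        ring
    _ = _ := by
        rw [mul_assoc, mul_assoc, ← ENNReal.rpow_add_of_nonneg _ _ hα0 (by norm_num)]
        congr 3
        rw [hα]
        have h1 : (n : ℝ) - 1 ≠ 0 := by linarith
        field_simp
        ring

lemma enorm_polar_le_lintegral {n : ℕ} {L : ℝ × Ed n →L[ℝ] Ed (n + 1)} (hL : IsSplitting L)
    {g : Ed (n + 1) → ℝ} (hg : ContDiff ℝ 1 g) (hc : HasCompactSupport g) (r : ℝ)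
    (z : Ed n) :
    ‖g (polar L r z)‖ₑ ≤ ∫⁻ ρ in Set.Ioi r, ‖fderiv ℝ g (polar L ρ z)‖ₑ := by
  have hdiff := hg.differentiable one_ne_zero
  set φ : ℝ → ℝ := fun ρ => g (polar L ρ z) with hφ
  have hφd : ContDiff ℝ 1 φ :=
    hg.comp ((contDiff_polar L).comp (contDiff_id.prodMk contDiff_const))
  have hnorm : ∀ ρ, ‖polar L ρ z‖ = |ρ| := by
    intro ρ
    have h1 : polar L ρ z = ρ • polar L 1 z := by simp [polar, smul_smul]
    rw [h1, norm_smul, norm_polar hL zero_le_one, mul_one, Real.norm_eq_abs]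
  obtain ⟨R, hR⟩ := hc.isCompact.isBounded.subset_closedBall (0 : Ed (n + 1))
  have hφc : HasCompactSupport fun ρ => φ (-ρ) := by
    refine HasCompactSupport.intro (isCompact_closedBall (0 : ℝ) R) fun ρ hρ => ?_
    by_contra hne
    have := hR (subset_tsupport _ hne)
    rw [mem_closedBall_zero_iff, hnorm, abs_neg] at this
    exact hρ (by simpa using this)
  have h := HasCompactSupport.enorm_le_lintegral_Ici_deriv
    (hφd.comp contDiff_neg) hφc (-r)
  simp only [Function.comp_apply, neg_neg] at h
  refine h.trans ?_
  have hd : ∀ ρ, deriv (φ ∘ Neg.neg) ρ = - deriv φ (-ρ) := fun ρ => deriv_comp_neg φ ρ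
  have hpre : Set.Iic (-r) = Neg.neg ⁻¹' Set.Ici r := by ext; simp
  have hchg := (Measure.measurePreserving_neg (volume : Measure ℝ)).setLIntegral_comp_preimage_emb
    (MeasurableEquiv.neg ℝ).measurableEmbedding (fun ρ => ‖deriv φ ρ‖ₑ) (Set.Ici r)
  calc ∫⁻ y in Set.Iic (-r), ‖deriv (φ ∘ Neg.neg) y‖ₑ
      = ∫⁻ y in Neg.neg ⁻¹' Set.Ici r, ‖deriv φ (-y)‖ₑ := by
        rw [hpre]; simp only [hd, enorm_neg]
    _ = ∫⁻ ρ in Set.Ioi r, ‖deriv φ ρ‖ₑ := by rw [hchg, setLIntegral_congr Ioi_ae_eq_Ici.symm]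
    _ ≤ _ := lintegral_mono fun ρ => by
        rw [enorm_le_iff_norm_le]
        exact norm_deriv_comp_polar_le hL hdiff ρ z

lemma exists_trace_const {n : ℕ} (hn : 4 ≤ n) (K : ℝ) : ∃ C : ℝ≥0∞, C ≠ ⊤ ∧
    ∀ L : ℝ × Ed n →L[ℝ] Ed (n + 1), IsSplitting L →
    ∀ f : Ed (n + 1) → ℝ, ContDiff ℝ 1 f → HasCompactSupport f → ∀ r : ℝ, 0 < r →
      ENNReal.ofReal (r ^ n) *
          ∫⁻ z in Metric.closedBall 0 K, ‖f (polar L r z)‖ₑ ^ (2 * n / (n - 1) : ℝ)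
        ≤ C * (∫⁻ x, ‖fderiv ℝ f x‖ₑ ^ (2 : ℝ)) ^ (n / (n - 1) : ℝ) := by
  have hn' : (4 : ℝ) ≤ n := by exact_mod_cast hn
  have hq1 : (1 : ℝ) < 2 * n / (n - 1) := by rw [lt_div_iff₀ (by linarith)]; linarith
  obtain ⟨C, hC, hmain⟩ := exists_lintegral_fderiv_rpow_const hn
  refine ⟨ENNReal.ofReal (√(1 + K ^ 2) ^ (n + 1)) * C, ENNReal.mul_ne_top ENNReal.ofReal_ne_top hC,
    fun L hL f hf hc r hr => ?_⟩
  set g : Ed (n + 1) → ℝ := fun x => ‖f x‖ ^ (2 * n / (n - 1) : ℝ) with hg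
  have hgd : ContDiff ℝ 1 g := hf.norm_rpow hq1
  have hgc : HasCompactSupport g :=
    hc.comp_left (g := fun y : ℝ => ‖y‖ ^ (2 * n / (n - 1) : ℝ))
      (by simp [Real.zero_rpow (by linarith : (2 * n / (n - 1) : ℝ) ≠ 0)])
  have hgm : Measurable fun x => ‖fderiv ℝ g x‖ₑ :=
    (hgd.continuous_fderiv one_ne_zero).enorm.measurable
  have hp := (continuous_polar L).measurable
  calc ENNReal.ofReal (r ^ n) *
        ∫⁻ z in Metric.closedBall 0 K, ‖f (polar L r z)‖ₑ ^ (2 * n / (n - 1) : ℝ)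
      = ∫⁻ z in Metric.closedBall 0 K, ENNReal.ofReal (r ^ n) * ‖g (polar L r z)‖ₑ := by
        rw [← lintegral_const_mul' _ _ ENNReal.ofReal_ne_top]
        refine lintegral_congr fun z => ?_
        rw [hg, Real.enorm_rpow_of_nonneg (norm_nonneg _) (by linarith), enorm_norm]
    _ ≤ ∫⁻ z in Metric.closedBall 0 K, ∫⁻ ρ in Set.Ioi (0 : ℝ),
          ENNReal.ofReal (ρ ^ n) * ‖fderiv ℝ g (polar L ρ z)‖ₑ := by
        refine lintegral_mono fun z => ?_
        calc ENNReal.ofReal (r ^ n) * ‖g (polar L r z)‖ₑ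
            ≤ ENNReal.ofReal (r ^ n) * ∫⁻ ρ in Set.Ioi r, ‖fderiv ℝ g (polar L ρ z)‖ₑ := by
              gcongr
              exact enorm_polar_le_lintegral hL hgd hgc r z
          _ = ∫⁻ ρ in Set.Ioi r, ENNReal.ofReal (r ^ n) * ‖fderiv ℝ g (polar L ρ z)‖ₑ :=
              (lintegral_const_mul' _ _ ENNReal.ofReal_ne_top).symm
          _ ≤ ∫⁻ ρ in Set.Ioi r, ENNReal.ofReal (ρ ^ n) * ‖fderiv ℝ g (polar L ρ z)‖ₑ := by
              refine setLIntegral_mono' measurableSet_Ioi fun ρ hρ => ?_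
              have hρ : r < ρ := hρ
              gcongr
          _ ≤ _ := lintegral_mono_set (Set.Ioi_subset_Ioi hr.le)
    _ = ∫⁻ ρ in Set.Ioi (0 : ℝ), ∫⁻ z in Metric.closedBall 0 K,
          ENNReal.ofReal (ρ ^ n) * ‖fderiv ℝ g (polar L ρ z)‖ₑ := by
        refine lintegral_lintegral_swap (Measurable.aemeasurable ?_)
        exact (by fun_prop : Measurable fun p : Ed n × ℝ => ENNReal.ofReal (p.2 ^ n)).mul
          (hgm.comp (hp.comp measurable_swap))
    _ = ∫⁻ ρ in Set.Ioi (0 : ℝ), ENNReal.ofReal (ρ ^ n) * ∫⁻ z in Metric.closedBall 0 K,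
          ‖fderiv ℝ g (polar L ρ z)‖ₑ :=
        lintegral_congr fun ρ => lintegral_const_mul' _ _ ENNReal.ofReal_ne_top
    _ ≤ ENNReal.ofReal (√(1 + K ^ 2) ^ (n + 1)) * ∫⁻ x, ‖fderiv ℝ g x‖ₑ :=
        lintegral_closedBall_polar_le hL hgm K
    _ ≤ _ := by
        rw [mul_assoc]
        gcongr
        exact hmain f hf hc

/-- The density controlled by the Morawetz estimate. -/
def morDensity {m : ℕ} (f : Ed m → ℝ) (x : Ed m) : ℝ :=
  angularSq f x / ‖x‖ + f x ^ 2 / ‖x‖ ^ 3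

lemma exists_angular_sobolev_const {n : ℕ} (hn : 4 ≤ n) : ∃ C : ℝ≥0∞, C ≠ ⊤ ∧
    ∀ L : ℝ × Ed n →L[ℝ] Ed (n + 1), IsSplitting L →
    ∀ f : Ed (n + 1) → ℝ, ContDiff ℝ 1 f → ∀ r : ℝ, 0 < r →
      (∫⁻ z in Metric.closedBall 0 √n, ‖f (polar L r z)‖ₑ ^ (2 * n / (n - 2) : ℝ))
          ^ ((n - 2) / n : ℝ)
        ≤ C * (ENNReal.ofReal (r ^ 3) *
          ∫⁻ z in Metric.closedBall 0 (√n + 1), ENNReal.ofReal (morDensity f (polar L r z))) := by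
  have hn' : (4 : ℝ) ≤ n := by exact_mod_cast hn
  obtain ⟨C, hC, hsob⟩ := exists_sobolev_const (m := n) (by omega)
  have hsn : 0 < √(n : ℝ) := Real.sqrt_pos.2 (by linarith)
  let χ : ContDiffBump (0 : Ed n) := ⟨√n, √n + 1, hsn, by linarith⟩
  have hχ : ContDiff ℝ 1 χ := χ.contDiff
  obtain ⟨D, hD⟩ := (χ.hasCompactSupport.fderiv (𝕜 := ℝ)).exists_bound_of_continuous
    (hχ.continuous_fderiv one_ne_zero)
  refine ⟨C * ENNReal.ofReal (2 * (1 + D ^ 2)), ENNReal.mul_ne_top hC ENNReal.ofReal_ne_top,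
    fun L hL f hf r hr => ?_⟩
  set F : Ed n → ℝ := fun z => f (polar L r z) with hF
  have hFd : ContDiff ℝ 1 F :=
    hf.comp ((contDiff_polar L).comp (contDiff_const.prodMk contDiff_id))
  set h : Ed n → ℝ := fun z => χ z * F z with hh
  have hhd : ContDiff ℝ 1 h := hχ.mul hFd
  have hhc : HasCompactSupport h := χ.hasCompactSupport.mul_right
  have hbound : ∀ z, ‖fderiv ℝ h z‖ ^ 2 ≤ 2 * (1 + D ^ 2) * (r ^ 3 * morDensity f (polar L r z)) := by
    intro z
    have h1 : fderiv ℝ h z = χ z • fderiv ℝ F z + F z • fderiv ℝ χ z :=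
      fderiv_fun_mul (hχ.differentiable one_ne_zero z) (hFd.differentiable one_ne_zero z)
    have h2 : ‖fderiv ℝ h z‖ ≤ ‖fderiv ℝ F z‖ + |F z| * D := by
      rw [h1]
      refine (norm_add_le _ _).trans (add_le_add ?_ ?_)
      · rw [norm_smul, Real.norm_eq_abs, abs_of_nonneg χ.nonneg]
        exact mul_le_of_le_one_left (norm_nonneg _) χ.le_one
      · rw [norm_smul, Real.norm_eq_abs]
        exact mul_le_mul_of_nonneg_left (hD z) (abs_nonneg _)
    have h3 := norm_fderiv_comp_polar_sq_le hL (hf.differentiable one_ne_zero) hr z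
    have h4 : r ^ 3 * morDensity f (polar L r z)
        = r ^ 2 * angularSq f (polar L r z) + F z ^ 2 := by
      rw [morDensity, norm_polar hL hr.le, hF]
      field_simp
    have h5 := angularSq_nonneg f (polar L r z)
    have h6 := pow_le_pow_left₀ (norm_nonneg _) h2 2
    rw [h4]
    have h7 : ‖fderiv ℝ F z‖ ^ 2 ≤ r ^ 2 * angularSq f (polar L r z) := h3
    have h8 : 0 ≤ D ^ 2 * (r ^ 2 * angularSq f (polar L r z)) := by positivity
    nlinarith [sq_nonneg (‖fderiv ℝ F z‖ - |F z| * D), sq_abs (F z), sq_nonneg (F z)]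
  have hzero : ∀ z, z ∉ Metric.closedBall (0 : Ed n) (√n + 1) → fderiv ℝ h z = 0 := by
    intro z hz
    by_contra hne
    have h1 := (tsupport_fderiv_subset ℝ) (subset_tsupport _ hne)
    have h2 : tsupport h ⊆ tsupport χ := closure_mono (Function.support_mul_subset_left _ _)
    have h3 := h2 h1
    rw [χ.tsupport_eq] at h3
    exact hz h3
  calc (∫⁻ z in Metric.closedBall 0 √n, ‖F z‖ₑ ^ (2 * n / (n - 2) : ℝ)) ^ ((n - 2) / n : ℝ)
      ≤ (∫⁻ z, ‖h z‖ₑ ^ (2 * n / (n - 2) : ℝ)) ^ ((n - 2) / n : ℝ) := by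
        refine ENNReal.rpow_le_rpow ?_ (div_nonneg (by linarith) (by linarith))
        refine le_trans ?_ (setLIntegral_le_lintegral (Metric.closedBall 0 √n) _)
        refine le_of_eq (setLIntegral_congr_fun measurableSet_closedBall fun z hz => ?_)
        have : χ z = 1 := χ.one_of_mem_closedBall hz
        simp [hh, this]
    _ ≤ C * ∫⁻ z, ‖fderiv ℝ h z‖ₑ ^ (2 : ℝ) := hsob h hhd hhc
    _ ≤ C * ∫⁻ z, (Metric.closedBall (0 : Ed n) (√n + 1)).indicator
          (fun z => ENNReal.ofReal (2 * (1 + D ^ 2)) * (ENNReal.ofReal (r ^ 3) *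
            ENNReal.ofReal (morDensity f (polar L r z)))) z := by
        gcongr with z
        by_cases hz : z ∈ Metric.closedBall (0 : Ed n) (√n + 1)
        · rw [Set.indicator_of_mem hz, ← ENNReal.ofReal_mul (by positivity),
            ← ENNReal.ofReal_mul (by positivity), ← ofReal_norm,
            ENNReal.ofReal_rpow_of_nonneg (norm_nonneg _) (by norm_num)]
          refine ENNReal.ofReal_le_ofReal ?_
          simpa using hbound z
        · have h0 : ‖fderiv ℝ h z‖ = 0 := by rw [hzero z hz]; exact norm_zero
          rw [← ofReal_norm, h0, ENNReal.ofReal_zero, ENNReal.zero_rpow_of_pos (by norm_num)]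
          exact zero_le
    _ = _ := by
        rw [lintegral_indicator measurableSet_closedBall,
          lintegral_const_mul' _ _ ENNReal.ofReal_ne_top,
          lintegral_const_mul' _ _ ENNReal.ofReal_ne_top, mul_assoc]

lemma exists_slice_const {n : ℕ} (hn : 4 ≤ n) : ∃ C : ℝ≥0∞, C ≠ ⊤ ∧
    ∀ L : ℝ × Ed n →L[ℝ] Ed (n + 1), IsSplitting L →
    ∀ f : Ed (n + 1) → ℝ, ContDiff ℝ 1 f → HasCompactSupport f → ∀ r : ℝ, 0 < r →
      ENNReal.ofReal (r ^ n) * ∫⁻ z in Metric.closedBall 0 √n,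
          ENNReal.ofReal (|f (polar L r z)| ^ (2 * (n + 1) / (n - 1) : ℝ) / ‖polar L r z‖)
        ≤ C * (∫⁻ x, ‖fderiv ℝ f x‖ₑ ^ (2 : ℝ)) ^ (2 / (n - 1) : ℝ) * (ENNReal.ofReal (r ^ n) *
          ∫⁻ z in Metric.closedBall 0 (√n + 1), ENNReal.ofReal (morDensity f (polar L r z))) := by
  have hn' : (4 : ℝ) ≤ n := by exact_mod_cast hn
  have hn1 : (n : ℝ) - 1 ≠ 0 := by linarith
  have hn2 : (n : ℝ) - 2 ≠ 0 := by linarith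
  obtain ⟨C₁, hC₁, hsob⟩ := exists_angular_sobolev_const hn
  obtain ⟨C₂, hC₂, htr⟩ := exists_trace_const hn √n
  refine ⟨C₁ * C₂ ^ (2 / n : ℝ), ENNReal.mul_ne_top hC₁
    (ENNReal.rpow_ne_top_of_nonneg (by positivity) hC₂), fun L hL f hf hc r hr => ?_⟩
  set E := ∫⁻ x, ‖fderiv ℝ f x‖ₑ ^ (2 : ℝ)
  set F : Ed n → ℝ := fun z => f (polar L r z) with hF
  have hFm : Measurable fun z => ‖F z‖ₑ :=
    (hf.continuous.comp ((continuous_polar L).comp (by fun_prop :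
      Continuous fun z : Ed n => (r, z)))).enorm.measurable
  set B := Metric.closedBall (0 : Ed n) √n
  set A := ∫⁻ z in B, ‖F z‖ₑ ^ (2 * n / (n - 1) : ℝ) with hA
  set T := ∫⁻ z in Metric.closedBall 0 (√n + 1), ENNReal.ofReal (morDensity f (polar L r z))
  have hs := hsob L hL f hf r hr
  have ht : ENNReal.ofReal (r ^ 2) * A ^ (2 / n : ℝ) ≤ C₂ ^ (2 / n : ℝ) * E ^ (2 / (n - 1) : ℝ) := by
    have h1 := ENNReal.rpow_le_rpow (htr L hL f hf hc r hr) (z := 2 / n) (by positivity)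
    rw [ENNReal.mul_rpow_of_nonneg _ _ (by positivity),
      ENNReal.mul_rpow_of_nonneg _ _ (by positivity), ← ENNReal.rpow_mul,
      ENNReal.ofReal_rpow_of_nonneg (by positivity) (by positivity), ← Real.rpow_natCast,
      ← Real.rpow_mul hr.le] at h1
    have e1 : (n : ℝ) * (2 / n) = 2 := by field_simp
    have e2 : (n / (n - 1) : ℝ) * (2 / n) = 2 / (n - 1) := by field_simp
    rw [e1, e2, Real.rpow_two] at h1
    exact h1
  have hconj : Real.HolderConjugate (n / (n - 2)) (n / 2) := by
    rw [Real.holderConjugate_iff]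
    refine ⟨by rw [lt_div_iff₀ (by linarith)]; linarith, ?_⟩
    field_simp
    ring
  have hhol : ∫⁻ z in B, ‖F z‖ₑ ^ (2 * (n + 1) / (n - 1) : ℝ)
      ≤ (∫⁻ z in B, ‖F z‖ₑ ^ (2 * n / (n - 2) : ℝ)) ^ ((n - 2) / n : ℝ) * A ^ (2 / n : ℝ) := by
    have h1 := ENNReal.lintegral_mul_le_Lp_mul_Lq (volume.restrict B) hconj
      (hFm.pow_const (2 : ℝ)).aemeasurable (hFm.pow_const (4 / (n - 1) : ℝ)).aemeasurable
    have e1 : (2 : ℝ) * (n / (n - 2)) = 2 * n / (n - 2) := by ring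
    have e2 : (4 / (n - 1) : ℝ) * (n / 2) = 2 * n / (n - 1) := by field_simp; norm_num
    have e3 : (2 : ℝ) + 4 / (n - 1) = 2 * (n + 1) / (n - 1) := by field_simp; ring
    simp only [Pi.mul_apply, ← ENNReal.rpow_mul, e1, e2, one_div_div] at h1
    refine le_trans (le_of_eq (lintegral_congr fun z => ?_)) h1
    rw [← e3, ENNReal.rpow_add_of_nonneg _ _ (by norm_num)
      (div_nonneg (by norm_num) (by linarith))]
  have hlhs : ∫⁻ z in B, ENNReal.ofReal
      (|F z| ^ (2 * (n + 1) / (n - 1) : ℝ) / ‖polar L r z‖)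
      = ENNReal.ofReal r⁻¹ * ∫⁻ z in B, ‖F z‖ₑ ^ (2 * (n + 1) / (n - 1) : ℝ) := by
    rw [← lintegral_const_mul' _ _ ENNReal.ofReal_ne_top]
    refine lintegral_congr fun z => ?_
    rw [norm_polar hL hr.le, div_eq_inv_mul, ENNReal.ofReal_mul (by positivity),
      ← ofReal_norm, ENNReal.ofReal_rpow_of_nonneg (norm_nonneg _)
        (div_nonneg (by linarith) (by linarith)), Real.norm_eq_abs]
  rw [hlhs]
  have hr3 : ENNReal.ofReal r⁻¹ * ENNReal.ofReal (r ^ 3) = ENNReal.ofReal (r ^ 2) := by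
    rw [← ENNReal.ofReal_mul (by positivity)]
    congr 1
    field_simp
  calc ENNReal.ofReal (r ^ n) * (ENNReal.ofReal r⁻¹ *
        ∫⁻ z in B, ‖F z‖ₑ ^ (2 * (n + 1) / (n - 1) : ℝ))
      ≤ ENNReal.ofReal (r ^ n) * (ENNReal.ofReal r⁻¹ *
        ((C₁ * (ENNReal.ofReal (r ^ 3) * T)) * A ^ (2 / n : ℝ))) := by
        gcongr
        refine hhol.trans ?_
        gcongr
    _ = ENNReal.ofReal (r ^ n) * C₁ * T *
        ((ENNReal.ofReal r⁻¹ * ENNReal.ofReal (r ^ 3)) * A ^ (2 / n : ℝ)) := by ring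
    _ ≤ ENNReal.ofReal (r ^ n) * C₁ * T * (C₂ ^ (2 / n : ℝ) * E ^ (2 / (n - 1) : ℝ)) := by
        rw [hr3]; gcongr
    _ = _ := by ring

lemma measurable_morDensity {m : ℕ} {f : Ed m → ℝ} (hf : ContDiff ℝ 1 f) :
    Measurable (morDensity f) := by
  have hg : Measurable (gradient f) :=
    ((InnerProductSpace.toDual ℝ (Ed m)).symm.continuous.comp
      (hf.continuous_fderiv one_ne_zero)).measurable
  have := hf.continuous.measurable
  unfold morDensity angularSq
  fun_prop

lemma exists_hardy_morawetz_const {n : ℕ} (hn : 4 ≤ n) : ∃ C : ℝ≥0∞, C ≠ ⊤ ∧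
    ∀ f : Ed (n + 1) → ℝ, ContDiff ℝ 1 f → HasCompactSupport f →
      ∫⁻ x, ENNReal.ofReal (|f x| ^ (2 * (n + 1) / (n - 1) : ℝ) / ‖x‖)
        ≤ C * (∫⁻ x, ‖fderiv ℝ f x‖ₑ ^ (2 : ℝ)) ^ (2 / (n - 1) : ℝ) *
          ∫⁻ x, ENNReal.ofReal (morDensity f x) := by
  have hn' : (4 : ℝ) ≤ n := by exact_mod_cast hn
  obtain ⟨C, hC, hslice⟩ := exists_slice_const hn
  refine ⟨Fintype.card (Fin (n + 1) × Bool) *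
    (C * ENNReal.ofReal (√(1 + (√n + 1) ^ 2) ^ (n + 1))), ENNReal.mul_ne_top (ENNReal.natCast_ne_top _)
    (ENNReal.mul_ne_top hC ENNReal.ofReal_ne_top), fun f hf hc => ?_⟩
  set E := ∫⁻ x, ‖fderiv ℝ f x‖ₑ ^ (2 : ℝ)
  have hfm := hf.continuous.measurable
  have hTm := measurable_morDensity hf
  rw [mul_assoc, mul_assoc]
  refine lintegral_le_of_forall_isSplitting fun L hL => ?_
  refine (setLIntegral_axisCone_le hL (by fun_prop)).trans ?_
  calc _ ≤ ∫⁻ r in Set.Ioi (0 : ℝ), C * E ^ (2 / (n - 1) : ℝ) * (ENNReal.ofReal (r ^ n) *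
          ∫⁻ z in Metric.closedBall 0 (√n + 1), ENNReal.ofReal (morDensity f (polar L r z))) :=
        setLIntegral_mono' measurableSet_Ioi fun r hr => hslice L hL f hf hc r hr
    _ = C * E ^ (2 / (n - 1) : ℝ) * ∫⁻ r in Set.Ioi (0 : ℝ), (ENNReal.ofReal (r ^ n) *
          ∫⁻ z in Metric.closedBall 0 (√n + 1), ENNReal.ofReal (morDensity f (polar L r z))) := by
        refine lintegral_const_mul _ ?_
        have hm : Measurable fun p : ℝ × Ed n => ENNReal.ofReal (morDensity f (polar L p.1 p.2)) :=
          (hTm.comp (continuous_polar L).measurable).ennreal_ofReal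
        exact (by fun_prop : Measurable fun r : ℝ => ENNReal.ofReal (r ^ n)).mul
          hm.lintegral_prod_right'
    _ ≤ C * E ^ (2 / (n - 1) : ℝ) * (ENNReal.ofReal (√(1 + (√n + 1) ^ 2) ^ (n + 1)) *
          ∫⁻ x, ENNReal.ofReal (morDensity f x)) := by
        gcongr
        exact lintegral_closedBall_polar_le hL hTm.ennreal_ofReal _
    _ = _ := by ring

lemma lintegral_morDensity_le {d : ℕ} (hd : 5 ≤ d) {a b R : ℝ} (hab : a < b)
    {u : ℝ → Ed d → ℝ} (hsol : IsWaveHartreeSol (Set.Icc a b) u)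
    (h0 : ∀ t ∈ Set.Icc a b, ∀ x : Ed d, R ≤ ‖x‖ → u t x = 0) {M : ℝ≥0∞} (hM : M < ⊤)
    (hE : ∀ t ∈ Set.Icc a b, ∫⁻ x : Ed d,
      ENNReal.ofReal (‖gradient (u t) x‖ ^ 2 + (timeDeriv u t x) ^ 2) ≤ M) :
    ∫⁻ t in Set.Icc a b, ∫⁻ x : Ed d, ENNReal.ofReal (morDensity (u t) x) ≤ M := by
  have hu := hsol.1
  have hdu : Differentiable ℝ (fun p : ℝ × Ed d => u p.1 p.2) := hu.differentiable two_ne_zero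
  have cu : Continuous (fun p : ℝ × Ed d => u p.1 p.2) := hu.continuous
  have cg : ∀ j, Continuous fun p : ℝ × Ed d => spaceDeriv u p.1 j p.2 := fun j =>
    (hu.continuous_fderiv two_ne_zero).clm_apply continuous_const
  let S : ℝ × Ed d → ℝ := fun p => ∑ i, spaceDeriv u p.1 i p.2 ^ 2
  let N : ℝ × Ed d → ℝ := fun p => (∑ i, p.2 i * spaceDeriv u p.1 i p.2) ^ 2
  have cS : Continuous S := by fun_prop
  have cN : Continuous N := by fun_prop
  let G : ℝ → ℝ × Ed d → ℝ := fun ε p =>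
    regInv ε p.2 * S p - regInv ε p.2 ^ 3 * N p + regInv ε p.2 ^ 3 * u p.1 p.2 ^ 2
  have hdens : ∀ p : ℝ × Ed d, morDensity (u p.1) p.2
      = ‖p.2‖⁻¹ * S p - ‖p.2‖⁻¹ ^ 3 * N p + ‖p.2‖⁻¹ ^ 3 * u p.1 p.2 ^ 2 := by
    intro p
    have hS : ‖gradient (u p.1) p.2‖ ^ 2 = S p := by
      simp [EuclideanSpace.norm_sq_eq, gradient_apply_eq_spaceDeriv hdu, S]
    have hN : ⟪p.2, gradient (u p.1) p.2⟫ ^ 2 = N p := by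
      rw [PiLp.inner_apply]
      simp [gradient_apply_eq_spaceDeriv hdu, N, mul_comm]
    rw [morDensity, angularSq, hS, hN]
    rcases eq_or_ne ‖p.2‖ 0 with h | h
    · simp [h]
    · field_simp
  have hmeas : Measurable fun p : ℝ × Ed d => ENNReal.ofReal (morDensity (u p.1) p.2) := by
    simp only [hdens]
    have := cS.measurable
    have := cN.measurable
    have := cu.measurable
    fun_prop
  have hlim : ∀ p : ℝ × Ed d, ENNReal.ofReal (morDensity (u p.1) p.2)
      ≤ Filter.liminf (fun k : ℕ => ENNReal.ofReal (G (1 / ((k : ℝ) + 1)) p)) Filter.atTop := by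
    intro p
    rcases eq_or_ne p.2 0 with h | h
    · rw [hdens]
      simp [h]
    have hpos : 0 < ‖p.2‖ := norm_pos_iff.2 h
    have h1 : Filter.Tendsto (fun k : ℕ => regInv (1 / ((k : ℝ) + 1)) p.2) Filter.atTop
        (nhds ‖p.2‖⁻¹) := by
      have h2 : Filter.Tendsto (fun ε : ℝ => regInv ε p.2) (nhds 0) (nhds ‖p.2‖⁻¹) := by
        have h3 : ContinuousAt (fun ε : ℝ => (√(ε ^ 2 + ‖p.2‖ ^ 2))⁻¹) 0 := by
          refine ContinuousAt.inv₀ (by fun_prop) ?_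
          simpa using h
        simpa [ContinuousAt, regInv] using h3
      exact h2.comp tendsto_one_div_add_atTop_nhds_zero_nat
    have h4 : Filter.Tendsto (fun k : ℕ => G (1 / ((k : ℝ) + 1)) p) Filter.atTop
        (nhds (morDensity (u p.1) p.2)) := by
      rw [hdens]
      exact ((h1.mul_const _).sub ((h1.pow 3).mul_const _)).add ((h1.pow 3).mul_const _)
    exact ((ENNReal.tendsto_ofReal h4).liminf_eq).ge
  rw [← lintegral_prod _ hmeas.aemeasurable]
  refine (lintegral_mono hlim).trans ((lintegral_liminf_le fun k => ?_).trans ?_)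
  · have hk : 0 < 1 / ((k : ℝ) + 1) := by positivity
    have c1 : Continuous fun p : ℝ × Ed d => regInv (1 / ((k : ℝ) + 1)) p.2 :=
      (continuous_regInv hk).comp continuous_snd
    exact (((c1.mul cS).sub ((c1.pow 3).mul cN)).add
      ((c1.pow 3).mul (cu.pow 2))).measurable.ennreal_ofReal
  · refine (Filter.liminf_le_liminf (v := fun _ : ℕ => M) (Filter.Eventually.of_forall fun k => ?_)).trans
      (by simp)
    have hk : 0 < 1 / ((k : ℝ) + 1) := by positivity
    refine le_trans (lintegral_mono fun p => ENNReal.ofReal_le_ofReal ?_)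
      (lintegral_morForm_le hd hab hk hsol h0 hM hE)
    exact morForm_ge hd hk _ _ _

/-- Morawetz estimate: for `d ≥ 5`, any classical solution on `[a,b]` with compact spatial
support and finite energy supremum `M` satisfies
`∫_a^b ∫ |u|^{2d/(d-2)}/|x| ≤ C(d) · M^{d/(d-2)}`. -/
theorem stmt0 (d : ℕ) (hd : 5 ≤ d) :
    ∃ C : ℝ, 0 < C ∧
      ∀ (a b : ℝ), a ≤ b →
      ∀ u : ℝ → Ed d → ℝ, IsWaveHartreeSol (Set.Icc a b) u →
      (∃ R > 0, ∀ t ∈ Set.Icc a b, ∀ x : Ed d, R ≤ ‖x‖ → u t x = 0) →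
      ∀ M : ℝ≥0∞,
        M = (⨆ t ∈ Set.Icc a b,
              ∫⁻ x : Ed d,
                ENNReal.ofReal (‖gradient (u t) x‖ ^ 2 + (timeDeriv u t x) ^ 2)) →
        M < ⊤ →
        (∫⁻ t in Set.Icc a b, ∫⁻ x : Ed d,
            ENNReal.ofReal (|u t x| ^ ((2 * d : ℝ) / ((d : ℝ) - 2)) / ‖x‖))
          ≤ ENNReal.ofReal C * M ^ ((d : ℝ) / ((d : ℝ) - 2)) := by
  obtain ⟨n, rfl⟩ : ∃ n, d = n + 1 := ⟨d - 1, by omega⟩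
  have hn : 4 ≤ n := by omega
  have hn' : (4 : ℝ) ≤ n := by exact_mod_cast hn
  obtain ⟨C, hC, hC'⟩ := exists_hardy_morawetz_const hn
  refine ⟨C.toReal + 1, by positivity, ?_⟩
  rintro a b hab u hsol ⟨R, -, h0⟩ M hMdef hM
  have hE : ∀ t ∈ Set.Icc a b, ∫⁻ x : Ed (n + 1),
      ENNReal.ofReal (‖gradient (u t) x‖ ^ 2 + (timeDeriv u t x) ^ 2) ≤ M := by
    intro t ht
    rw [hMdef]
    exact le_iSup₂ (f := fun t _ => ∫⁻ x : Ed (n + 1),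
      ENNReal.ofReal (‖gradient (u t) x‖ ^ 2 + (timeDeriv u t x) ^ 2)) t ht
  rcases hab.eq_or_lt with rfl | hlt
  · simp
  have e1 : (2 * ((n + 1 : ℕ) : ℝ)) / (((n + 1 : ℕ) : ℝ) - 2) = 2 * (n + 1) / (n - 1) := by
    push_cast; ring
  have e2 : ((n + 1 : ℕ) : ℝ) / (((n + 1 : ℕ) : ℝ) - 2) = 2 / (n - 1) + 1 := by
    have h1 : (n : ℝ) - 1 ≠ 0 := by linarith
    have h2 : ((n + 1 : ℕ) : ℝ) - 2 = n - 1 := by push_cast; ring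
    rw [h2]; push_cast; field_simp; ring
  have hexp : 0 ≤ 2 / ((n : ℝ) - 1) := div_nonneg (by norm_num) (by linarith)
  have hslice : ∀ t ∈ Set.Icc a b, ∫⁻ x : Ed (n + 1),
      ENNReal.ofReal (|u t x| ^ (2 * (n + 1) / (n - 1) : ℝ) / ‖x‖)
        ≤ C * M ^ (2 / (n - 1) : ℝ) * ∫⁻ x, ENNReal.ofReal (morDensity (u t) x) := by
    intro t ht
    have hf : ContDiff ℝ 1 (u t) :=
      (hsol.1.comp (contDiff_const.prodMk contDiff_id : ContDiff ℝ 2 fun x : Ed (n + 1) =>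
        (t, x))).of_le one_le_two
    refine (hC' (u t) hf (hasCompactSupport_of_zero (R := R) fun x hx => h0 t ht x hx.le)).trans ?_
    gcongr
    refine (lintegral_mono fun x => ?_).trans (hE t ht)
    rw [← ofReal_norm, ENNReal.ofReal_rpow_of_nonneg (norm_nonneg _) (by norm_num),
      Real.rpow_two, norm_gradient_eq]
    exact ENNReal.ofReal_le_ofReal (le_add_of_nonneg_right (sq_nonneg _))
  rw [e1, e2]
  calc _ ≤ ∫⁻ t in Set.Icc a b, C * M ^ (2 / (n - 1) : ℝ) *
          ∫⁻ x, ENNReal.ofReal (morDensity (u t) x) := setLIntegral_mono' measurableSet_Icc hslice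
    _ = C * M ^ (2 / (n - 1) : ℝ) * ∫⁻ t in Set.Icc a b,
          ∫⁻ x, ENNReal.ofReal (morDensity (u t) x) :=
        lintegral_const_mul' _ _
          (ENNReal.mul_ne_top hC (ENNReal.rpow_ne_top_of_nonneg hexp hM.ne))
    _ ≤ C * M ^ (2 / (n - 1) : ℝ) * M := by
        gcongr
        exact lintegral_morDensity_le hd hlt hsol h0 hM hE
    _ = C * M ^ (2 / (n - 1) + 1 : ℝ) := by
        rw [ENNReal.rpow_add_of_nonneg _ _ hexp zero_le_one, ENNReal.rpow_one, mul_assoc]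
    _ ≤ _ := by
        gcongr
        refine (ENNReal.ofReal_toReal hC).ge.trans (ENNReal.ofReal_le_ofReal ?_)
        linarith
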